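/- arXiv:1311.3179 — 3 statements merged into one kernel-verified Lean document; each statement's English description precedes it below -/
import Mathlib

section
/- Let S = Σᵢ₌₁ⁿ aᵢrᵢ be a Rademacher sum with E[(|S|-1)₊²] ≤ ρ², and let t > 1. Then (E|S|^t)^{1/t} ≤ 2 + 4ρ·((2t-1)/(t-1))^{t/2}. -/
lemma gibbs0 (f b : ℝ) (hf : 0 ≤ f) (hb : 0 ≤ b) (h : b = 0 → f = 0) :
    f * (Real.log b - Real.log f) ≤ b - f := by
  rcases hf.eq_or_lt with h0 | h0
  · subst h0; simpa using hb
  · have hb' : 0 < b := lt_of_le_of_ne hb (fun e => by have := h e.symm; linarith)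
    rw [← Real.log_div hb'.ne' h0.ne']
    have := Real.log_le_sub_one_of_pos (div_pos hb' h0)
    calc f * Real.log (b / f) ≤ f * (b / f - 1) := by gcongr
      _ = b - f := by field_simp

lemma psi1 (s : ℝ) (h0 : 0 ≤ s) (h1 : s < 1) :
    (1 + s) * Real.log (1 + s) - (1 - s) * Real.log (1 - s) ≤ 2 * s := by
  have hd : ∀ x ∈ Set.Ico (0:ℝ) 1, HasDerivAt (fun x : ℝ => 2 * x - ((1 + x) * Real.log (1 + x) - (1 - x) * Real.log (1 - x)))
      (- Real.log (1 - x ^ 2)) x := by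
    intro x hx
    have hp : (1 + x) ≠ 0 := by linarith [hx.1]
    have hm : (1 - x) ≠ 0 := by linarith [hx.2]
    have e1 : HasDerivAt (fun x : ℝ => 1 + x) 1 x := (hasDerivAt_id x).const_add 1
    have e2 : HasDerivAt (fun x : ℝ => 1 - x) (-1) x := (hasDerivAt_id x).const_sub 1
    have := ((hasDerivAt_id x).const_mul 2).sub ((e1.mul (e1.log hp)).sub (e2.mul (e2.log hm)))
    refine this.congr_deriv ?_
    rw [show 1 - x ^ 2 = (1 + x) * (1 - x) by ring, Real.log_mul hp hm]
    field_simp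
    ring
  have hmono : MonotoneOn (fun x : ℝ => 2 * x - ((1 + x) * Real.log (1 + x) - (1 - x) * Real.log (1 - x))) (Set.Ico 0 1) := by
    apply monotoneOn_of_deriv_nonneg (convex_Ico 0 1)
    · exact fun x hx => (hd x hx).continuousAt.continuousWithinAt
    · exact fun x hx => (hd x (interior_subset hx)).differentiableAt.differentiableWithinAt
    · intro x hx
      have hx := interior_subset hx
      rw [(hd x hx).deriv]
      have := Real.log_nonpos (x := 1 - x ^ 2) (by nlinarith [hx.1, hx.2]) (by nlinarith [hx.1])
      linarith
  have := hmono (by simp) ⟨h0, h1⟩ h0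
  simp at this
  linarith

lemma psi2 (s : ℝ) (h0 : 0 ≤ s) (h1 : s ≤ 1) :
    (1 + s) ^ 2 * Real.log (1 + s) + (1 - s) ^ 2 * Real.log (1 - s) ≤ 3 * s ^ 2 := by
  have hd : ∀ x ∈ Set.Ioo (0:ℝ) 1, HasDerivAt (fun x : ℝ => 3 * x ^ 2 - ((1 + x) * ((1 + x) * Real.log (1 + x)) + (1 - x) * ((1 - x) * Real.log (1 - x))))
      (2 * (2 * x - ((1 + x) * Real.log (1 + x) - (1 - x) * Real.log (1 - x)))) x := by
    intro x hx
    have hp : (1 + x) ≠ 0 := by linarith [hx.1]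
    have hm : (1 - x) ≠ 0 := by linarith [hx.2]
    have e1 : HasDerivAt (fun x : ℝ => 1 + x) 1 x := (hasDerivAt_id x).const_add 1
    have e2 : HasDerivAt (fun x : ℝ => 1 - x) (-1) x := (hasDerivAt_id x).const_sub 1
    have := (((hasDerivAt_id x).pow 2).const_mul 3).sub ((e1.mul (e1.mul (e1.log hp))).add (e2.mul (e2.mul (e2.log hm))))
    refine this.congr_deriv ?_
    simp
    field_simp
    ring
  have hmono : MonotoneOn (fun x : ℝ => 3 * x ^ 2 - ((1 + x) * ((1 + x) * Real.log (1 + x)) + (1 - x) * ((1 - x) * Real.log (1 - x)))) (Set.Icc 0 1) := by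
    apply monotoneOn_of_deriv_nonneg (convex_Icc 0 1)
    · have c1 : Continuous (fun x : ℝ => (1 + x) * Real.log (1 + x)) :=
        Real.continuous_mul_log.comp (continuous_const.add continuous_id)
      have c2 : Continuous (fun x : ℝ => (1 - x) * Real.log (1 - x)) :=
        Real.continuous_mul_log.comp (continuous_const.sub continuous_id)
      fun_prop
    · rw [interior_Icc]
      exact fun x hx => (hd x hx).differentiableAt.differentiableWithinAt
    · rw [interior_Icc]
      intro x hx
      rw [(hd x hx).deriv]
      linarith [psi1 x hx.1.le hx.2]
  have := hmono (by simp) ⟨h0, h1⟩ h0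
  simp at this
  linarith

/-- Two-point entropy. -/
noncomputable def HH (x y : ℝ) : ℝ :=
  x * Real.log x + y * Real.log y - (x + y) * Real.log ((x + y) / 2)

lemma HH_comm (x y : ℝ) : HH x y = HH y x := by
  unfold HH; rw [add_comm x y]; ring

lemma logsob' (α β : ℝ) (hb : 0 ≤ β) (h : β ≤ α) : HH (α ^ 2) (β ^ 2) ≤ (α - β) ^ 2 := by
  rcases (hb.trans h).eq_or_lt with h0 | h0
  · have : β = 0 := by linarith
    subst this; subst h0; simp [HH]
  set g := (α + β) / 2 with hg
  have hgp : 0 < g := by positivity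
  set s := (α - β) / (2 * g) with hs
  have hs0 : 0 ≤ s := div_nonneg (by linarith) (by positivity)
  have hs1 : s ≤ 1 := by rw [hs, div_le_one (by positivity)]; linarith
  have ea : α = g * (1 + s) := by rw [hs]; field_simp; rw [hg]; ring
  have eb : β = g * (1 - s) := by rw [hs]; field_simp; rw [hg]; ring
  have hG := gibbs0 (α ^ 2 + β ^ 2) (2 * g ^ 2) (by positivity) (by positivity) (fun h => by
    have : 0 < 2 * g ^ 2 := by positivity
    linarith)
  have hf0 : α ^ 2 + β ^ 2 ≠ 0 := by positivity
  rw [Real.log_mul two_ne_zero (by positivity), Real.log_pow] at hG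
  have l1 : α ^ 2 * Real.log (α ^ 2) = 2 * α ^ 2 * (Real.log g + Real.log (1 + s)) := by
    rw [Real.log_pow, ea, Real.log_mul (by positivity) (by positivity)]; push_cast; ring
  have l2 : β ^ 2 * Real.log (β ^ 2) = 2 * β ^ 2 * (Real.log g + Real.log (1 - s)) := by
    rcases hs1.eq_or_lt with h1 | h1
    · rw [eb, h1]; simp
    · rw [Real.log_pow, eb, Real.log_mul (by positivity) (by linarith)]; push_cast; ring
  have hp := mul_le_mul_of_nonneg_left (psi2 s hs0 hs1) (by positivity : 0 ≤ 2 * g ^ 2)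
  unfold HH
  rw [l1, l2, Real.log_div hf0 two_ne_zero]
  push_cast at hG
  have e3 : α ^ 2 = g ^ 2 * (1 + s) ^ 2 := by rw [ea]; ring
  have e4 : β ^ 2 = g ^ 2 * (1 - s) ^ 2 := by rw [eb]; ring
  have e5 : (α - β) ^ 2 = 4 * g ^ 2 * s ^ 2 := by rw [ea, eb]; ring
  have e6 : α ^ 2 + β ^ 2 = 2 * g ^ 2 + 2 * g ^ 2 * s ^ 2 := by rw [e3, e4]; ring
  rw [e5]
  have e7 : 2 * α ^ 2 * Real.log (1 + s) + 2 * β ^ 2 * Real.log (1 - s) =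
    2 * g ^ 2 * ((1 + s) ^ 2 * Real.log (1 + s) + (1 - s) ^ 2 * Real.log (1 - s)) := by
    rw [e3, e4]; ring
  nlinarith [hG, hp, e7, e6]

lemma logsob (α β : ℝ) (ha : 0 ≤ α) (hb : 0 ≤ β) : HH (α ^ 2) (β ^ 2) ≤ (α - β) ^ 2 := by
  rcases le_total β α with h | h
  · exact logsob' α β hb h
  · rw [HH_comm, show (α - β) ^ 2 = (β - α) ^ 2 by ring]; exact logsob' β α ha h

lemma sinh_scale (c z : ℝ) (hc0 : 0 ≤ c) (hc1 : c ≤ 1) (hz : 0 ≤ z) :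
    Real.sinh (c * z) ≤ c * Real.sinh z := by
  have hd : ∀ x, HasDerivAt (fun z : ℝ => c * Real.sinh z - Real.sinh (c * z))
     (c * Real.cosh x - Real.cosh (c * x) * c) x := by
    intro x
    have e : HasDerivAt (fun z : ℝ => c * z) c x := by simpa using (hasDerivAt_id x).const_mul c
    exact ((Real.hasDerivAt_sinh x).const_mul c).sub e.sinh
  have hmono : MonotoneOn (fun z : ℝ => c * Real.sinh z - Real.sinh (c * z)) (Set.Ici 0) := by
    apply monotoneOn_of_deriv_nonneg (convex_Ici 0)
    · exact fun x hx => (hd x).continuousAt.continuousWithinAt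
    · exact fun x hx => (hd x).differentiableAt.differentiableWithinAt
    · intro x hx
      have hx : 0 ≤ x := interior_subset hx
      rw [(hd x).deriv]
      have : Real.cosh (c * x) ≤ Real.cosh x := by
        rw [Real.cosh_le_cosh, abs_of_nonneg hx, abs_of_nonneg (by positivity)]
        nlinarith
      nlinarith
  have := hmono (by simp) hz hz
  simp at this
  linarith

lemma sv1 (p w : ℝ) (hp : 2 ≤ p) (hw : 1 ≤ w) :
    (w ^ (p / 2) - 1) ^ 2 ≤ p ^ 2 / (4 * (p - 1)) * ((w - 1) * (w ^ (p - 1) - 1)) := by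
  have hw0 : 0 < w := by linarith
  set z := Real.log w / 4 with hz
  have hz0 : 0 ≤ z := div_nonneg (Real.log_nonneg hw) (by norm_num)
  have hsc := sinh_scale ((p - 2) / p) (p * z) (div_nonneg (by linarith) (by linarith))
    (by rw [div_le_one (by linarith)]; linarith) (by positivity)
  rw [show (p - 2) / p * (p * z) = (p - 2) * z by field_simp, Real.sinh_eq, Real.sinh_eq, Real.exp_neg,
    Real.exp_neg] at hsc
  set E := Real.exp (p * z) with hE
  set D := Real.exp ((p - 2) * z) with hD
  have hE0 : 0 < E := Real.exp_pos _
  have hD0 : 0 < D := Real.exp_pos _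
  have hD1 : 1 ≤ D := Real.one_le_exp (mul_nonneg (by linarith) hz0)
  have w1 : w ^ (p / 2) = E ^ 2 := by
    rw [Real.rpow_def_of_pos hw0, hE, ← Real.exp_nat_mul]; congr 1; rw [hz]; push_cast; ring
  have w2 : w ^ (p - 1) = E ^ 2 * D ^ 2 := by
    rw [Real.rpow_def_of_pos hw0, hE, hD, ← Real.exp_nat_mul, ← Real.exp_nat_mul, ← Real.exp_add]; congr 1; rw [hz]; push_cast; ring
  have w3 : w * D ^ 2 = E ^ 2 := by
    nth_rewrite 1 [← Real.exp_log hw0]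
    rw [hE, hD, ← Real.exp_nat_mul, ← Real.exp_nat_mul, ← Real.exp_add]
    congr 1; rw [hz]; push_cast; ring
  have w4 : w = E ^ 2 / D ^ 2 := by field_simp; exact w3
  rw [w1, w2]
  rw [w4]
  set X := E - E⁻¹ with hX
  set Y := D - D⁻¹ with hY
  have hY0 : 0 ≤ Y := by
    have : D⁻¹ ≤ 1 := inv_le_one_of_one_le₀ hD1
    linarith
  have hYX : p * Y ≤ (p - 2) * X := by
    have h1 : Y ≤ (p - 2) / p * X := by linarith
    have := mul_le_mul_of_nonneg_left h1 (by linarith : 0 ≤ p)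
    rwa [← mul_assoc, mul_div_cancel₀ _ (by linarith)] at this
  have k1 : (E ^ 2 - 1) ^ 2 = E ^ 2 * X ^ 2 := by rw [hX]; field_simp
  have k2 : (E ^ 2 / D ^ 2 - 1) * (E ^ 2 * D ^ 2 - 1) = E ^ 2 * (X ^ 2 - Y ^ 2) := by
    rw [hX, hY]; field_simp; ring
  rw [k1, k2, div_mul_eq_mul_div, le_div_iff₀ (by linarith)]
  have : (p * Y) ^ 2 ≤ ((p - 2) * X) ^ 2 := by
    apply pow_le_pow_left₀ _ hYX; positivity
  have := mul_le_mul_of_nonneg_left this (by positivity : 0 ≤ E ^ 2)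
  nlinarith

lemma sv2 (p u v : ℝ) (hp : 2 < p) (hv : 0 ≤ v) (huv : v ≤ u) :
    (u ^ (p / 2) - v ^ (p / 2)) ^ 2 ≤ p ^ 2 / (4 * (p - 1)) * ((u - v) * (u ^ (p - 1) - v ^ (p - 1))) := by
  rcases hv.eq_or_lt with h0 | h0
  · subst h0
    rw [Real.zero_rpow (by linarith), Real.zero_rpow (by linarith)]
    simp only [sub_zero]
    have e : u * u ^ (p - 1) = (u ^ (p / 2)) ^ 2 := by
      rcases huv.eq_or_lt with h1 | h1
      · rw [← h1, Real.zero_rpow (by linarith), Real.zero_rpow (by linarith)]; simp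
      · rw [← Real.rpow_natCast, ← Real.rpow_mul h1.le]
        nth_rewrite 1 [← Real.rpow_one u]
        rw [← Real.rpow_add h1]; congr 1; push_cast; ring
    rw [e]
    have : 1 ≤ p ^ 2 / (4 * (p - 1)) := by
      rw [le_div_iff₀ (by linarith)]; nlinarith
    nlinarith [sq_nonneg (u ^ (p / 2))]
  · have := sv1 p (u / v) hp.le (by rwa [le_div_iff₀ h0, one_mul])
    have hu : 0 < u := by linarith
    rw [Real.div_rpow hu.le hv, Real.div_rpow hu.le hv] at this
    have hvp : v ^ p = v ^ (p / 2) * v ^ (p / 2) := by rw [← Real.rpow_add h0]; congr 1; ring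
    have hvp' : v ^ p = v * v ^ (p - 1) := by
      nth_rewrite 2 [← Real.rpow_one v]
      rw [← Real.rpow_add h0]; congr 1; ring
    have q1 : 0 < v ^ (p / 2) := Real.rpow_pos_of_pos h0 _
    have q2 : 0 < v ^ (p - 1) := Real.rpow_pos_of_pos h0 _
    have q3 : 0 < v ^ p := Real.rpow_pos_of_pos h0 _
    have := mul_le_mul_of_nonneg_left this q3.le
    calc _ = v ^ p * (u ^ (p / 2) / v ^ (p / 2) - 1) ^ 2 := by rw [hvp]; field_simp
      _ ≤ _ := this
      _ = p ^ 2 / (4 * (p - 1)) * (v ^ p * ((u / v - 1) * (u ^ (p - 1) / v ^ (p - 1) - 1))) := by ring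
      _ = _ := by congr 1; rw [hvp']; field_simp

/-- signed power -/
noncomputable def phi (p u : ℝ) : ℝ := u * |u| ^ (p - 2)

lemma phi_neg (p u : ℝ) : phi p (-u) = - phi p u := by simp [phi]

lemma phi_nonneg (p u : ℝ) (hp : 2 < p) (hu : 0 ≤ u) : phi p u = u ^ (p - 1) := by
  unfold phi
  rw [abs_of_nonneg hu]
  rcases hu.eq_or_lt with h | h
  · rw [← h, Real.zero_rpow (by linarith : p - 1 ≠ 0)]; simp
  · nth_rewrite 1 [← Real.rpow_one u]
    rw [← Real.rpow_add h]; congr 1; ring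

lemma mul_phi (p u : ℝ) (hp : 2 < p) : u * phi p u = |u| ^ p := by
  unfold phi
  rcases eq_or_ne u 0 with h | h
  · rw [h]; simp; rw [Real.zero_rpow (by linarith)]
  · have h := abs_pos.2 h
    rw [← mul_assoc, ← abs_mul_abs_self u]
    nth_rewrite 1 2 [← Real.rpow_one |u|]
    rw [← Real.rpow_add h, ← Real.rpow_add h]; congr 1; ring

lemma sv3 (p u v : ℝ) (hp : 2 < p) (huv : |v| ≤ |u|) :
    (|u| ^ (p / 2) - |v| ^ (p / 2)) ^ 2 ≤ p ^ 2 / (4 * (p - 1)) * ((u - v) * (phi p u - phi p v)) := by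
  refine (sv2 p _ _ hp (abs_nonneg v) huv).trans ?_
  have hK : 0 ≤ p ^ 2 / (4 * (p - 1)) := div_nonneg (by positivity) (by linarith)
  refine mul_le_mul_of_nonneg_left ?_ hK
  have a1 : 0 ≤ |u| ^ (p - 1) := by positivity
  have a2 : 0 ≤ |v| ^ (p - 1) := by positivity
  have b1 := abs_nonneg u
  have b2 := abs_nonneg v
  have c1 := phi_nonneg p |u| hp b1
  have c2 := phi_nonneg p |v| hp b2
  have d1 : ∀ w : ℝ, (|w| = w ∧ phi p |w| = phi p w) ∨ (|w| = -w ∧ phi p |w| = - phi p w) := by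
    intro w
    rcases abs_cases w with ⟨h, -⟩ | ⟨h, -⟩
    · left; rw [h]; simp
    · right; rw [h, phi_neg]; simp
  rw [← c1] at a1 ⊢
  rw [← c2] at a2 ⊢
  rcases d1 u with ⟨h1, h2⟩ | ⟨h1, h2⟩ <;> rcases d1 v with ⟨h3, h4⟩ | ⟨h3, h4⟩ <;>
    rw [h2] at a1 ⊢ <;> rw [h4] at a2 ⊢ <;> rw [h1] at b1 ⊢ <;> rw [h3] at b2 ⊢ <;>
    nlinarith [mul_nonneg a1 b2, mul_nonneg a2 b1]

lemma two_point (p u v : ℝ) (hp : 2 < p) :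
    HH (|u| ^ p) (|v| ^ p) ≤ p ^ 2 / (2 * (p - 1)) * ((u - v) / 2 * (phi p u - phi p v)) := by
  have hsq : ∀ u : ℝ, |u| ^ p = (|u| ^ (p / 2)) ^ 2 := by
    intro u
    rw [← Real.rpow_natCast, ← Real.rpow_mul (abs_nonneg _)]; congr 1; push_cast; ring
  rw [hsq, hsq]
  refine (logsob _ _ (by positivity) (by positivity)).trans ?_
  have e : p ^ 2 / (2 * (p - 1)) * ((u - v) / 2 * (phi p u - phi p v)) =
     p ^ 2 / (4 * (p - 1)) * ((u - v) * (phi p u - phi p v)) := by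
    have : p - 1 ≠ 0 := by linarith
    field_simp; ring
  rw [e]
  rcases le_total |v| |u| with h | h
  · exact sv3 p u v hp h
  · have := sv3 p v u hp h
    linarith

lemma HH_ge (x y p q : ℝ) (hx : 0 ≤ x) (hy : 0 ≤ y) (hp : 0 ≤ p) (hq : 0 ≤ q) (hpq : p + q = 2)
    (h1 : p = 0 → x = 0) (h2 : q = 0 → y = 0) : x * Real.log p + y * Real.log q ≤ HH x y := by
  rcases (add_nonneg hx hy).eq_or_lt with h | h
  · have : x = 0 := by linarith
    have h' : y = 0 := by linarith
    simp [this, h', HH]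
  set m := (x + y) / 2 with hm
  have hm0 : 0 < m := by positivity
  have g1 := gibbs0 x (p * m) hx (by positivity) (fun h => h1 (by simpa [hm0.ne'] using h))
  have g2 := gibbs0 y (q * m) hy (by positivity) (fun h => h2 (by simpa [hm0.ne'] using h))
  have l1 : x * Real.log (p * m) = x * (Real.log p + Real.log m) := by
    by_cases h : p = 0
    · simp [h1 h]
    · rw [Real.log_mul h hm0.ne']
  have l2 : y * Real.log (q * m) = y * (Real.log q + Real.log m) := by
    by_cases h : q = 0
    · simp [h2 h]
    · rw [Real.log_mul h hm0.ne']
  rw [mul_sub, l1] at g1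
  rw [mul_sub, l2] at g2
  unfold HH
  rw [← hm]
  have : p * m + q * m = x + y := by rw [← add_mul, hpq, hm]; ring
  linarith

lemma HH_sum {ι : Type*} [Fintype ι] (X Y : ι → ℝ) (hX : ∀ i, 0 ≤ X i) (hY : ∀ i, 0 ≤ Y i) :
    HH (∑ i, X i) (∑ i, Y i) ≤ ∑ i, HH (X i) (Y i) := by
  set A := ∑ i, X i with hA
  set B := ∑ i, Y i with hB
  have hA0 : 0 ≤ A := Finset.sum_nonneg fun i _ => hX i
  have hB0 : 0 ≤ B := Finset.sum_nonneg fun i _ => hY i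
  have zA : A = 0 → ∀ i, X i = 0 := fun h i =>
    (Finset.sum_eq_zero_iff_of_nonneg fun i _ => hX i).1 h i (Finset.mem_univ i)
  have zB : B = 0 → ∀ i, Y i = 0 := fun h i =>
    (Finset.sum_eq_zero_iff_of_nonneg fun i _ => hY i).1 h i (Finset.mem_univ i)
  rcases (add_nonneg hA0 hB0).eq_or_lt with h | h
  · have h1 : A = 0 := by linarith
    have h2 : B = 0 := by linarith
    simp [h1, h2, zA h1, zB h2, HH]
  set m := (A + B) / 2 with hm
  have hm0 : 0 < m := by positivity
  have key : ∀ i, X i * Real.log (A / m) + Y i * Real.log (B / m) ≤ HH (X i) (Y i) := by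
    intro i
    apply HH_ge _ _ _ _ (hX i) (hY i) (by positivity) (by positivity)
    · rw [← add_div, hm]; field_simp
    · intro h; exact zA (by simpa [hm0.ne'] using h) i
    · intro h; exact zB (by simpa [hm0.ne'] using h) i
  refine le_trans (le_of_eq ?_) (Finset.sum_le_sum fun i _ => key i)
  rw [Finset.sum_add_distrib, ← Finset.sum_mul, ← Finset.sum_mul, ← hA, ← hB]
  unfold HH
  rw [← hm]
  have l1 : A * Real.log (A / m) = A * (Real.log A - Real.log m) := by
    by_cases h : A = 0
    · simp [h]
    · rw [Real.log_div h hm0.ne']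
  have l2 : B * Real.log (B / m) = B * (Real.log B - Real.log m) := by
    by_cases h : B = 0
    · simp [h]
    · rw [Real.log_div h hm0.ne']
  rw [l1, l2]; ring

/-- Rademacher sum. -/
def RS {n : ℕ} (a : Fin n → ℝ) (x : Fin n → Bool) : ℝ := ∑ i, a i * (if x i then (1 : ℝ) else -1)

lemma sum_cons (n : ℕ) (F : (Fin (n + 1) → Bool) → ℝ) :
    ∑ x, F x = ∑ x : Fin n → Bool, F (Fin.cons true x) + ∑ x : Fin n → Bool, F (Fin.cons false x) := by
  rw [← (Fin.consEquiv (fun _ : Fin (n + 1) => Bool)).sum_comp, Fintype.sum_prod_type, Fintype.sum_bool]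
  rfl

lemma RS_cons {n : ℕ} (a : Fin (n + 1) → ℝ) (b : Bool) (x : Fin n → Bool) :
    RS a (Fin.cons b x) = a 0 * (if b then (1 : ℝ) else -1) + RS (fun i => a i.succ) x := by
  simp [RS, Fin.sum_univ_succ]

lemma ent_main (p : ℝ) (hp : 2 < p) (n : ℕ) : ∀ (a : Fin n → ℝ) (c : ℝ),
    ∑ x, |c + RS a x| ^ p * Real.log (|c + RS a x| ^ p)
      - (∑ x, |c + RS a x| ^ p) * Real.log ((∑ x, |c + RS a x| ^ p) / 2 ^ n)
    ≤ p ^ 2 / (2 * (p - 1)) * ∑ x, RS a x * phi p (c + RS a x) := by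
  induction n with
  | zero => intro a c; simp [RS]
  | succ n ih =>
    intro a c
    have i1 := ih (fun i => a i.succ) (c + a 0)
    have i2 := ih (fun i => a i.succ) (c - a 0)
    simp only [sum_cons, RS_cons]
    simp only [if_true, Bool.false_eq_true, if_false, mul_one, mul_neg, ← add_assoc, ← sub_eq_add_neg]
    set b : Fin n → ℝ := fun i => a i.succ
    have h1 := HH_sum (fun x => |c + a 0 + RS b x| ^ p) (fun x => |c - a 0 + RS b x| ^ p)
      (fun x => by positivity) (fun x => by positivity)
    have h2 := Finset.sum_le_sum (s := Finset.univ) fun x _ => two_point p (c + a 0 + RS b x) (c - a 0 + RS b x) hp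
    have h3 := h1.trans h2
    rw [← Finset.mul_sum] at h3
    set K := p ^ 2 / (2 * (p - 1))
    have e : ∑ x, (a 0 + RS b x) * phi p (c + a 0 + RS b x) + ∑ x, (-a 0 + RS b x) * phi p (c - a 0 + RS b x)
      = ∑ x, RS b x * phi p (c + a 0 + RS b x) + ∑ x, RS b x * phi p (c - a 0 + RS b x)
       + ∑ x, (c + a 0 + RS b x - (c - a 0 + RS b x)) / 2 * (phi p (c + a 0 + RS b x) - phi p (c - a 0 + RS b x)) := by
      simp only [← Finset.sum_add_distrib]
      refine Finset.sum_congr rfl fun x _ => ?_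
      ring
    rw [e, mul_add, mul_add]
    refine le_trans (le_of_eq ?_) (add_le_add (add_le_add i1 i2) h3)
    unfold HH
    set A := ∑ x, |c + a 0 + RS b x| ^ p with hA
    set B := ∑ x, |c - a 0 + RS b x| ^ p with hB
    have hA0 : 0 ≤ A := Finset.sum_nonneg fun i _ => by positivity
    have hB0 : 0 ≤ B := Finset.sum_nonneg fun i _ => by positivity
    have hl : ∀ (T : ℝ) (k : ℕ), T * Real.log (T / 2 ^ k) = T * Real.log T - T * (k * Real.log 2) := by
      intro T k
      by_cases h : T = 0
      · simp [h]
      · rw [Real.log_div h (by positivity), Real.log_pow]; ring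
    have hl1 := hl (A + B) 1
    rw [pow_one] at hl1
    rw [hl, hl, hl, hl1]
    push_cast
    ring

lemma num_bound (t : ℝ) (ht : 2 < t) :
    4 / 3 * (t ^ 2 / (2 * (t - 1)) + Real.log 4) - Real.log 3
      ≤ Real.log 4 + t * Real.log ((2 * t - 1) / (t - 1)) := by
  have ht1 : 0 < t - 1 := by linarith
  set s := 1 / (t - 1) with hs
  have hs0 : 0 < s := by positivity
  have hs1 : s ≤ 1 := by rw [hs, div_le_one ht1]; linarith
  have e1 : (2 * t - 1) / (t - 1) = (1 - s) * 2 + s * 3 := by rw [hs]; field_simp; ring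
  have e2 : t = (1 + s) / s := by rw [hs]; field_simp; ring
  have e3 : t ^ 2 / (2 * (t - 1)) = (1 + s) ^ 2 / (2 * s) := by rw [hs]; field_simp; ring
  have hc := strictConcaveOn_log_Ioi.concaveOn.2 (x := 2) (y := 3) (by simp) (by simp)
    (by linarith : 0 ≤ 1 - s) hs0.le (by ring)
  simp only [smul_eq_mul] at hc
  have l4 : Real.log 4 = 2 * Real.log 2 := by
    rw [show (4:ℝ) = 2 ^ 2 by norm_num, Real.log_pow]; norm_num
  have l2 := Real.log_two_gt_d9
  have l2' := Real.log_two_lt_d9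
  have l3 : 1.09 < Real.log 3 := by
    rw [Real.lt_log_iff_exp_lt (by norm_num)]
    have h1 := Real.exp_one_lt_d9
    have h2 : Real.exp 0.09 ≤ 1.1 := by
      have := Real.exp_bound_div_one_sub_of_interval (x := 0.09) (by norm_num) (by norm_num)
      refine this.trans (by norm_num)
    rw [show (1.09:ℝ) = 1 + 0.09 by norm_num, Real.exp_add]
    nlinarith [Real.exp_pos 1, Real.exp_pos 0.09]
  rw [e1, e3, l4, e2]
  set L := Real.log ((1 - s) * 2 + s * 3)
  rw [← sub_nonneg]
  have : 2 * Real.log 2 + (1 + s) / s * L - (4 / 3 * ((1 + s) ^ 2 / (2 * s) + 2 * Real.log 2) - Real.log 3)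
    = ((1 + s) * L - 2 / 3 * (1 + s) ^ 2 + s * (Real.log 3 - 2 / 3 * Real.log 2)) / s := by
    field_simp; ring
  rw [this]
  apply div_nonneg _ hs0.le
  have h5 := mul_le_mul_of_nonneg_left hc (by linarith : 0 ≤ 1 + s)
  nlinarith [mul_nonneg hs0.le (sub_nonneg.2 hs1), mul_pos hs0 hs0, mul_pos hs0 (sub_pos.2 l3),
    mul_pos (mul_pos hs0 hs0) (sub_pos.2 l3), mul_pos hs0 (sub_pos.2 l2), mul_pos hs0 (sub_pos.2 l2')]

lemma small_t (n : ℕ) (S : (Fin n → Bool) → ℝ) (ρ t : ℝ) (hρ : 0 ≤ ρ) (ht : 1 < t) (ht2 : t ≤ 2)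
    (hS : (∑ x, max (|S x| - 1) 0 ^ 2) / 2 ^ n ≤ ρ ^ 2) :
    ((∑ x, |S x| ^ t) / 2 ^ n) ^ (1 / t) ≤ 1 + ρ := by
  have hw : ∑ x : Fin n → Bool, (1 / 2 ^ n : ℝ) = 1 := by simp
  have hw0 : ∀ x ∈ (Finset.univ : Finset (Fin n → Bool)), (0:ℝ) ≤ 1 / 2 ^ n := fun x _ => by positivity
  have e : ∀ F : (Fin n → Bool) → ℝ, (∑ x, F x) / 2 ^ n = ∑ x, 1 / 2 ^ n * F x := by
    intro F; rw [← Finset.mul_sum]; ring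
  have h1 := Real.rpow_arith_mean_le_arith_mean_rpow Finset.univ (fun _ => 1 / 2 ^ n)
    (fun x => |S x| ^ t) hw0 hw (fun x _ => by positivity) (p := 2 / t)
    (by rw [le_div_iff₀ (by linarith)]; linarith)
  have h2 := Real.pow_arith_mean_le_arith_mean_pow Finset.univ (fun _ => 1 / 2 ^ n)
    (fun x => max (|S x| - 1) 0) hw0 hw (fun x _ => by positivity) 2
  rw [← e] at h1 h2
  rw [← e] at h2
  have hm : (∑ x, max (|S x| - 1) 0) / 2 ^ n ≤ ρ := (le_abs_self _).trans (abs_le_of_sq_le_sq (h2.trans hS) hρ)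
  have h3 : ∑ x, 1 / 2 ^ n * (|S x| ^ t) ^ (2 / t) ≤ (1 + ρ) ^ 2 := by
    have : ∀ x ∈ (Finset.univ : Finset (Fin n → Bool)), (1 / 2 ^ n : ℝ) * (|S x| ^ t) ^ (2 / t) ≤
      1 / 2 ^ n + 2 * (1 / 2 ^ n * max (|S x| - 1) 0) + 1 / 2 ^ n * max (|S x| - 1) 0 ^ 2 := by
      intro x _
      rw [← Real.rpow_mul (abs_nonneg _), mul_div_cancel₀ _ (by linarith : t ≠ 0), Real.rpow_two]
      have a1 := le_max_left (|S x| - 1) 0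
      have : |S x| ^ 2 ≤ 1 + 2 * max (|S x| - 1) 0 + max (|S x| - 1) 0 ^ 2 := by
        nlinarith [abs_nonneg (S x), le_max_right (|S x| - 1) 0]
      have := mul_le_mul_of_nonneg_left this (by positivity : (0:ℝ) ≤ 1 / 2 ^ n)
      linarith
    refine (Finset.sum_le_sum this).trans ?_
    rw [Finset.sum_add_distrib, Finset.sum_add_distrib, ← Finset.mul_sum, ← e, ← e, hw]
    nlinarith
  have h4 := h1.trans h3
  set Z := (∑ x, |S x| ^ t) / 2 ^ n with hZ
  have hZ0 : 0 ≤ Z := div_nonneg (Finset.sum_nonneg fun i _ => by positivity) (by positivity)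
  have : (Z ^ (1 / t)) ^ 2 ≤ (1 + ρ) ^ 2 := by
    rw [← Real.rpow_natCast, ← Real.rpow_mul hZ0]
    have h5 : 1 / t * ((2 : ℕ) : ℝ) = 2 / t := by push_cast; ring
    rw [h5]; exact h4
  exact (le_abs_self _).trans (abs_le_of_sq_le_sq this (by linarith))

lemma large_t (n : ℕ) (S : (Fin n → Bool) → ℝ) (ρ t : ℝ) (hρ : 0 ≤ ρ) (ht : 2 < t)
    (hS : (∑ x, max (|S x| - 1) 0 ^ 2) / 2 ^ n ≤ ρ ^ 2)
    (hE : ∑ x, |S x| ^ t * Real.log (|S x| ^ t)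
      - (∑ x, |S x| ^ t) * Real.log ((∑ x, |S x| ^ t) / 2 ^ n)
    ≤ t ^ 2 / (2 * (t - 1)) * ∑ x, |S x| ^ t) :
    ((∑ x, |S x| ^ t) / 2 ^ n) ^ (1 / t) ≤ 2 + 4 * ρ * ((2 * t - 1) / (t - 1)) ^ (t / 2) := by
  set C := (2 * t - 1) / (t - 1) with hC
  have hC0 : 0 < C := div_pos (by linarith) (by linarith)
  set T := ∑ x, |S x| ^ t with hT
  set m := T / 2 ^ n with hm
  have hT0 : 0 ≤ T := Finset.sum_nonneg fun i _ => by positivity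
  have hm0 : 0 ≤ m := by positivity
  set M := m ^ (1 / t) with hM
  rcases le_or_gt M 2 with h2 | h2
  · have : 0 ≤ 4 * ρ * C ^ (t / 2) := by positivity
    linarith
  have hMt : M ^ t = m := by
    rw [hM, ← Real.rpow_mul hm0]; rw [one_div_mul_cancel (by linarith), Real.rpow_one]
  have hmp : 0 < m := by rw [← hMt]; apply Real.rpow_pos_of_pos; linarith
  have hN : (0:ℝ) < 2 ^ n := by positivity
  have hTm : T = 2 ^ n * m := by rw [hm]; field_simp
  clear_value M
  clear hM
  clear_value m
  clear hm
  have hTp : 0 < T := by rw [hTm]; exact mul_pos hN hmp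
  classical
  set A := Finset.univ.filter (fun x => M / 2 ≤ |S x|) with hA
  have split : ∀ F : (Fin n → Bool) → ℝ, ∑ x, F x = ∑ x ∈ A, F x + ∑ x ∈ Aᶜ, F x := fun F =>
    (Finset.sum_add_sum_compl A F).symm
  have hcard : (A.card : ℝ) + (Aᶜ.card : ℝ) = 2 ^ n := by
    have := split (fun _ => 1); simp at this; simpa using this.symm
  have hoff : ∀ x ∈ Aᶜ, |S x| ^ t ≤ m / 4 := by
    intro x hx
    have hx : |S x| < M / 2 := by simpa [hA] using hx
    have := Real.rpow_le_rpow (abs_nonneg _) hx.le (by linarith : 0 ≤ t)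
    rw [Real.div_rpow (by linarith) (by norm_num), hMt] at this
    have h4 : (4:ℝ) ≤ 2 ^ t := by
      have := Real.rpow_le_rpow_of_exponent_le (x := 2) (by norm_num) ht.le
      norm_num at this; exact this
    exact this.trans (by gcongr)
  have hQ : 3 / 4 * T ≤ ∑ x ∈ A, |S x| ^ t := by
    have h1 := split (fun x => |S x| ^ t)
    have h2 := Finset.sum_le_card_nsmul _ _ _ hoff
    rw [nsmul_eq_mul] at h2
    have h3 : (Aᶜ.card : ℝ) * (m / 4) ≤ 2 ^ n * (m / 4) := by
      gcongr; have := Nat.cast_nonneg (α := ℝ) A.card; linarith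
    linarith
  have hk : 0 < (A.card : ℝ) := by
    rw [Nat.cast_pos, Finset.card_pos]
    by_contra h
    rw [Finset.not_nonempty_iff_eq_empty] at h
    rw [h] at hQ; simp at hQ; linarith
  set P := (A.card : ℝ) / 2 ^ n with hP
  have hP0 : 0 < P := by positivity
  have hP1 : P ≤ 1 := by
    rw [hP, div_le_one hN]; have := Nat.cast_nonneg (α := ℝ) Aᶜ.card; linarith
  have l3P : 0 ≤ Real.log (3 / P) := Real.log_nonneg (by rw [le_div_iff₀ hP0]; linarith)
  -- Gibbs
  have g1 : ∀ x ∈ A, |S x| ^ t * (Real.log (3 / P) + Real.log m - Real.log 4) - |S x| ^ t * Real.log (|S x| ^ t) ≤ 3 / P * m / 4 - |S x| ^ t := by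
    intro x _
    have := gibbs0 (|S x| ^ t) (3 / P * m / 4) (by positivity) (by positivity)
      (fun h => absurd h (by positivity))
    rw [Real.log_div (by positivity) (by norm_num), Real.log_mul (by positivity) hmp.ne', mul_sub] at this
    exact this
  have g2 : ∀ x ∈ Aᶜ, |S x| ^ t * (Real.log m - Real.log 4) - |S x| ^ t * Real.log (|S x| ^ t) ≤ m / 4 - |S x| ^ t := by
    intro x _
    have := gibbs0 (|S x| ^ t) (m / 4) (by positivity) (by positivity)
      (fun h => absurd h (by positivity))
    rw [Real.log_div (by positivity) (by norm_num), mul_sub] at this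
    exact this
  have s1 := Finset.sum_le_sum g1
  have s2 := Finset.sum_le_sum g2
  rw [Finset.sum_sub_distrib, Finset.sum_sub_distrib, ← Finset.sum_mul, Finset.sum_const, nsmul_eq_mul] at s1 s2
  have t1 := split (fun x => |S x| ^ t)
  have t2 := split (fun x => |S x| ^ t * Real.log (|S x| ^ t))
  rw [← hT] at t1
  rw [t2] at hE
  have t3 : (A.card : ℝ) * (3 / P * m / 4) = 3 / 4 * T := by
    rw [hP, hTm]; field_simp
  have t4 : (Aᶜ.card : ℝ) * (m / 4) ≤ T / 4 := by
    rw [hTm]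
    have : (Aᶜ.card : ℝ) * (m / 4) ≤ 2 ^ n * (m / 4) := by gcongr; linarith
    linarith
  set K := t ^ 2 / (2 * (t - 1)) with hK
  set QA := ∑ x ∈ A, |S x| ^ t
  set QB := ∑ x ∈ Aᶜ, |S x| ^ t
  have g3 : QA * Real.log (3 / P) ≤ (K + Real.log 4) * T := by
    rw [t3] at s1
    have : QA * (Real.log m - Real.log 4) + QB * (Real.log m - Real.log 4) = T * (Real.log m - Real.log 4) := by rw [t1]; ring
    linarith
  have g4 : 3 / 4 * Real.log (3 / P) ≤ K + Real.log 4 := by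
    have := (mul_le_mul_of_nonneg_right hQ l3P).trans g3
    refine le_of_mul_le_mul_right (a := T) ?_ hTp
    linarith
  have g5 := num_bound t ht
  rw [← hC, ← hK] at g5
  rw [Real.log_div (by norm_num) hP0.ne'] at g4
  have g6 : 0 ≤ Real.log (P * (4 * C ^ t)) := by
    rw [Real.log_mul hP0.ne' (by positivity), Real.log_mul (by norm_num) (by positivity), Real.log_rpow hC0]
    linarith
  have g7 : 1 ≤ P * (4 * C ^ t) := by
    rwa [Real.log_nonneg_iff (by positivity)] at g6
  have ch : P * (M / 2 - 1) ^ 2 ≤ ρ ^ 2 := by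
    refine le_trans ?_ hS
    rw [hP, div_mul_eq_mul_div]
    gcongr
    have h1 : ∀ x ∈ A, (M / 2 - 1) ^ 2 ≤ max (|S x| - 1) 0 ^ 2 := by
      intro x hx
      have hx : M / 2 ≤ |S x| := by simpa [hA] using hx
      apply pow_le_pow_left₀ (by linarith)
      exact le_max_of_le_left (by linarith)
    have h3 := Finset.card_nsmul_le_sum _ _ _ h1
    rw [nsmul_eq_mul] at h3
    exact h3.trans (Finset.sum_le_sum_of_subset_of_nonneg (Finset.subset_univ _) fun x _ _ => by positivity)
  have hCC : C ^ t = (C ^ (t / 2)) ^ 2 := by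
    rw [← Real.rpow_natCast, ← Real.rpow_mul hC0.le]; congr 1; push_cast; ring
  have fin : (M / 2 - 1) ^ 2 ≤ (2 * ρ * C ^ (t / 2)) ^ 2 := by
    calc (M / 2 - 1) ^ 2 ≤ (P * (4 * C ^ t)) * (M / 2 - 1) ^ 2 := le_mul_of_one_le_left (sq_nonneg _) g7
      _ = 4 * C ^ t * (P * (M / 2 - 1) ^ 2) := by ring
      _ ≤ 4 * C ^ t * ρ ^ 2 := by gcongr
      _ = _ := by rw [hCC]; ring
  have := (le_abs_self _).trans (abs_le_of_sq_le_sq fin (by positivity))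
  linarith


/-- For a Rademacher sum `S = ∑ aᵢrᵢ` with `E[(|S|-1)₊²] ≤ ρ²` and `t > 1`,
`‖S‖_t ≤ 2 + 4ρ·((2t-1)/(t-1))^{t/2}`. -/
theorem stmt_8 (n : ℕ) (a : Fin n → ℝ) (ρ t : ℝ) (hρ : 0 ≤ ρ) (ht : 1 < t)
    (hS : (∑ x : Fin n → Bool,
        max (|∑ i, a i * (if x i then (1 : ℝ) else -1)| - 1) 0 ^ 2) / 2 ^ n ≤ ρ ^ 2) :
    ((∑ x : Fin n → Bool,
        |∑ i, a i * (if x i then (1 : ℝ) else -1)| ^ t) / 2 ^ n) ^ (1 / t)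
      ≤ 2 + 4 * ρ * ((2 * t - 1) / (t - 1)) ^ (t / 2) := by
  rcases le_or_gt t 2 with h | h
  · refine (small_t n (RS a) ρ t hρ ht h hS).trans ?_
    have : 1 ≤ ((2 * t - 1) / (t - 1)) ^ (t / 2) := by
      apply Real.one_le_rpow _ (by linarith)
      rw [le_div_iff₀ (by linarith)]; linarith
    nlinarith
  · refine large_t n (RS a) ρ t hρ h hS ?_
    have := ent_main t h n a 0
    simp only [zero_add, mul_phi t _ h] at this
    exact this
end

section
/- Let a₁ ≥ a₂ ≥ ... ≥ aₙ ≥ 0 and S = Σᵢ aᵢrᵢ a Rademacher sum. If E[(|S|-1)₊²] ≤ ρ² and t > 1, then (Σ_{i>t} aᵢ²)^{1/2} ≤ (4/√t)·(2 + 4ρ·((2t-1)/(t-1))^{t/2}). -/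
open Classical

/-- The sign of a Boolean. -/
noncomputable def sgnB (b : Bool) : ℝ := if b then (1 : ℝ) else -1

/-- Rademacher sum. -/
noncomputable def radS {n : ℕ} (b : Fin n → ℝ) (x : Fin n → Bool) : ℝ := ∑ i, b i * sgnB (x i)

lemma sum_cube_succ (n : ℕ) (F : ℝ → ℝ) (b : Fin (n + 1) → ℝ) :
    ∑ x, F (radS b x) = ∑ x : Fin n → Bool,
      (F (b 0 + radS (fun i => b i.succ) x) + F (-b 0 + radS (fun i => b i.succ) x)) := by
  rw [← (Fin.consEquiv (fun _ : Fin (n + 1) => Bool)).sum_comp, Fintype.sum_prod_type]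
  simp [radS, Fin.sum_univ_succ, sgnB, Finset.sum_add_distrib, Fin.consEquiv]

lemma rad_moments (n : ℕ) : ∀ b : Fin n → ℝ,
    ∑ x, radS b x ^ 2 = 2 ^ n * ∑ i, b i ^ 2 ∧
    ∑ x, radS b x ^ 4 ≤ 3 * 2 ^ n * (∑ i, b i ^ 2) ^ 2 := by
  induction n with
  | zero => intro b; simp [radS]
  | succ n ih =>
    intro b
    obtain ⟨h2, h4⟩ := ih (fun i => b i.succ)
    rw [sum_cube_succ n (fun y => y ^ 2) b, sum_cube_succ n (fun y => y ^ 4) b,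
      Fin.sum_univ_succ]
    set s := ∑ i : Fin n, b i.succ ^ 2 with hs
    set Z := radS (fun i => b i.succ) with hZ
    have e2 : ∀ x, (b 0 + Z x) ^ 2 + (-b 0 + Z x) ^ 2 = 2 * b 0 ^ 2 + 2 * Z x ^ 2 := by
      intro x; ring
    have e4 : ∀ x, (b 0 + Z x) ^ 4 + (-b 0 + Z x) ^ 4
        = 2 * b 0 ^ 4 + 12 * b 0 ^ 2 * Z x ^ 2 + 2 * Z x ^ 4 := by
      intro x; ring
    simp only [e2, e4, Finset.sum_add_distrib, ← Finset.mul_sum, h2]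
    simp only [Finset.sum_const, Finset.card_univ, Fintype.card_pi, Fintype.card_bool,
      Finset.prod_const, Fintype.card_fin, nsmul_eq_mul]
    push_cast
    constructor
    · ring
    · have hp : (0 : ℝ) < 2 ^ n := by positivity
      have : 0 ≤ (2 : ℝ) ^ n * b 0 ^ 4 := by positivity
      rw [pow_succ 2 n]
      nlinarith

lemma khin (n : ℕ) (b : Fin n → ℝ) :
    2 ^ n * (Real.sqrt (∑ i, b i ^ 2) / 2) ≤ ∑ x, |radS b x| := by
  obtain ⟨h2, h4⟩ := rad_moments n b
  set v := ∑ i, b i ^ 2 with hv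
  have hv0 : 0 ≤ v := Finset.sum_nonneg (fun i _ => sq_nonneg _)
  set s := Real.sqrt v with hs
  have hs2 : s ^ 2 = v := Real.sq_sqrt hv0
  have hs0 : 0 ≤ s := Real.sqrt_nonneg _
  rcases hs0.eq_or_lt with h0 | hpos
  · rw [← h0]; simp; exact Finset.sum_nonneg (fun i _ => abs_nonneg _)
  have pt : ∀ x, s ^ 2 * radS b x ^ 2 - 4 / 27 * radS b x ^ 4 ≤ s ^ 3 * |radS b x| := by
    intro x
    have h1 : radS b x ^ 2 = |radS b x| ^ 2 := (sq_abs _).symm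
    have h3 : radS b x ^ 4 = (|radS b x| ^ 2) ^ 2 := by rw [← h1]; ring
    rw [h1, h3]
    set y := |radS b x|
    have hy : 0 ≤ y := abs_nonneg _
    have : 0 ≤ 4 / 27 * (y * ((y - 3 / 2 * s) ^ 2 * (y + 3 * s))) := by positivity
    nlinarith
  have hsum := Finset.sum_le_sum (fun x (_ : x ∈ Finset.univ) => pt x)
  rw [Finset.sum_sub_distrib, ← Finset.mul_sum, ← Finset.mul_sum, ← Finset.mul_sum, h2] at hsum
  rw [← hs2] at hsum h4
  have hp : (0 : ℝ) < 2 ^ n := by positivity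
  have key : s ^ 3 * (2 ^ n * (s / 2)) ≤ s ^ 3 * ∑ x, |radS b x| := by
    have : 0 ≤ (2 : ℝ) ^ n * s ^ 4 := by positivity
    nlinarith
  exact le_of_mul_le_mul_left key (by positivity)

lemma sgnB_beq (b d : Bool) : sgnB (b == d) = sgnB b * sgnB d := by
  cases b <;> cases d <;> simp [sgnB]

/-- Restriction of coefficients to a block. -/
noncomputable def blk {n k : ℕ} (a : Fin n → ℝ) (c : Fin n → Fin k) (j : Fin k) : Fin n → ℝ :=
  fun i => if c i = j then a i else 0

lemma radS_flip {n k : ℕ} (a : Fin n → ℝ) (c : Fin n → Fin k) (d : Fin k → Bool)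
    (x : Fin n → Bool) :
    radS a (fun i => x i == d (c i)) = ∑ j, sgnB (d j) * radS (blk a c j) x := by
  simp only [radS, blk, Finset.mul_sum, sgnB_beq]
  rw [Finset.sum_comm]
  refine Finset.sum_congr rfl fun i _ => ?_
  rw [Finset.sum_eq_single (c i)]
  · simp; ring
  · intro j _ hj; simp [hj.symm]
  · simp

lemma flip_sum {n k : ℕ} (c : Fin n → Fin k) (d : Fin k → Bool) (G : (Fin n → Bool) → ℝ) :
    ∑ x : Fin n → Bool, G (fun i => x i == d (c i)) = ∑ x, G x := by
  have hinv : Function.Involutive (fun (x : Fin n → Bool) => fun i => x i == d (c i)) := by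
    intro x; funext i
    simp only
    cases x i <;> cases d (c i) <;> rfl
  exact Equiv.sum_comp (hinv.toPerm _) G

lemma block_bound {n k : ℕ} (a : Fin n → ℝ) (c : Fin n → Fin k) (F : ℝ → ℝ)
    (hF : ∀ y, 0 ≤ F y) :
    ∑ x, F (∑ j, |radS (blk a c j) x|) ≤ 2 ^ k * ∑ x, F (radS a x) := by
  have h1 : ∑ d : Fin k → Bool, ∑ x : Fin n → Bool, F (radS a (fun i => x i == d (c i)))
      = 2 ^ k * ∑ x, F (radS a x) := by
    rw [Finset.sum_congr rfl fun d _ => flip_sum c d (fun x => F (radS a x))]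
    simp
  rw [← h1, Finset.sum_comm]
  refine Finset.sum_le_sum fun x _ => ?_
  have h2 : F (∑ j, |radS (blk a c j) x|)
      = F (radS a (fun i => x i == (fun j => decide (0 ≤ radS (blk a c j) x)) (c i))) := by
    rw [radS_flip a c (fun j => decide (0 ≤ radS (blk a c j) x)) x]
    congr 1
    refine Finset.sum_congr rfl fun j _ => ?_
    by_cases h : 0 ≤ radS (blk a c j) x
    · simp [sgnB, h, abs_of_nonneg]
    · simp [sgnB, h, abs_of_neg (not_le.mp h)]
  rw [h2]
  exact Finset.single_le_sum (f := fun d : Fin k → Bool => F (radS a (fun i => x i == d (c i))))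
    (fun d _ => hF _) (Finset.mem_univ (fun j => decide (0 ≤ radS (blk a c j) x)))

lemma tail_bound {n k : ℕ} (hk : 0 < k) (a : Fin n → ℝ)
    (ha : ∀ i j : Fin n, i ≤ j → a j ≤ a i) (ha0 : ∀ i, 0 ≤ a i) (j : Fin k) :
    ∑ i ∈ Finset.univ.filter (fun i : Fin n => k ≤ (i : ℕ)), a i ^ 2 ≤
      k * ∑ i, blk a (fun i : Fin n => (⟨(i : ℕ) % k, Nat.mod_lt _ hk⟩ : Fin k)) j i ^ 2 := by
  set c := (fun i : Fin n => (⟨(i : ℕ) % k, Nat.mod_lt _ hk⟩ : Fin k)) with hc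
  have hg : ∀ i : Fin n, k ≤ (i : ℕ) → ((i : ℕ) / k - 1) * k + j ≤ i := by
    intro i hi
    have h1 := Nat.div_pos hi hk
    have h2 := Nat.div_mul_le_self (i : ℕ) k
    have h3 := j.2
    obtain ⟨q, hq⟩ : ∃ q, (i : ℕ) / k = q + 1 := ⟨(i : ℕ) / k - 1, by omega⟩
    rw [hq] at h2 ⊢
    rw [add_mul] at h2
    simp only [Nat.add_sub_cancel]
    omega
  let g : Fin n → Fin n := fun i =>
    if h : k ≤ (i : ℕ) then ⟨((i : ℕ) / k - 1) * k + j, (hg i h).trans_lt i.2⟩ else i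
  have hgv : ∀ i : Fin n, k ≤ (i : ℕ) → (g i : ℕ) = ((i : ℕ) / k - 1) * k + j := by
    intro i hi; simp [g, hi]
  have hR : (k : ℝ) * ∑ i, blk a c j i ^ 2 = ∑ p : Fin k × Fin n, blk a c j p.2 ^ 2 := by
    rw [Fintype.sum_prod_type]; simp
  rw [hR]
  set T := Finset.univ.filter (fun i : Fin n => k ≤ (i : ℕ)) with hT
  have hinj : Set.InjOn (fun i => (c i, g i)) (T : Set (Fin n)) := by
    intro i hi l hl h
    simp only [hT, Finset.coe_filter, Finset.mem_univ, true_and, Set.mem_ofPred_eq] at hi hl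
    simp only [Prod.mk.injEq] at h
    obtain ⟨h1, h2⟩ := h
    have h1' : (i : ℕ) % k = (l : ℕ) % k := by simpa [hc] using h1
    have h2' := congrArg Fin.val h2
    rw [hgv i hi, hgv l hl] at h2'
    have h3 : (i : ℕ) / k - 1 = (l : ℕ) / k - 1 :=
      Nat.eq_of_mul_eq_mul_right hk (by omega)
    have h4 := Nat.div_pos hi hk
    have h5 := Nat.div_pos hl hk
    have h6 : (i : ℕ) / k = (l : ℕ) / k := by omega
    apply Fin.ext
    rw [← Nat.div_add_mod (i : ℕ) k, ← Nat.div_add_mod (l : ℕ) k, h6, h1']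
  calc ∑ i ∈ T, a i ^ 2 ≤ ∑ i ∈ T, blk a c j (g i) ^ 2 := by
        refine Finset.sum_le_sum fun i hi => ?_
        have hi' : k ≤ (i : ℕ) := by simpa [hT] using hi
        have hcg : c (g i) = j := by
          apply Fin.ext
          simp only [hc]
          rw [hgv i hi', Nat.mul_add_mod', Nat.mod_eq_of_lt j.2]
        have : a i ≤ a (g i) := ha _ _ (by
          rw [Fin.le_def, hgv i hi']; exact hg i hi')
        simp only [blk, hcg, if_true]
        exact pow_le_pow_left₀ (ha0 i) this 2
    _ = ∑ p ∈ T.image (fun i => (c i, g i)), blk a c j p.2 ^ 2 := by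
        rw [Finset.sum_image hinj]
    _ ≤ _ := Finset.sum_le_sum_of_subset_of_nonneg (Finset.subset_univ _)
        (fun _ _ _ => sq_nonneg _)

theorem stmt_9 (n : ℕ) (a : Fin n → ℝ) (ρ t : ℝ) (hρ : 0 ≤ ρ) (ht : 1 < t)
    (ha : ∀ i j : Fin n, i ≤ j → a j ≤ a i) (ha0 : ∀ i, 0 ≤ a i)
    (hS : (∑ x : Fin n → Bool,
        max (|∑ i, a i * (if x i then (1 : ℝ) else -1)| - 1) 0 ^ 2) / 2 ^ n ≤ ρ ^ 2) :
    Real.sqrt (∑ i ∈ Finset.univ.filter (fun i : Fin n => t < (i : ℕ) + 1), a i ^ 2)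
      ≤ (4 / Real.sqrt t) * (2 + 4 * ρ * ((2 * t - 1) / (t - 1)) ^ (t / 2)) := by
  have ht0 : 0 < t := by linarith
  obtain ⟨k, hkdef⟩ : ∃ k, k = ⌊t⌋₊ := ⟨_, rfl⟩
  have hk : 0 < k := by rw [hkdef]; exact Nat.floor_pos.mpr ht.le
  have hkt : (k : ℝ) ≤ t := by rw [hkdef]; exact Nat.floor_le ht0.le
  have htk : t < k + 1 := by rw [hkdef]; exact Nat.lt_floor_add_one t
  have hk1 : (1 : ℝ) ≤ k := by exact_mod_cast hk
  have hfil : Finset.univ.filter (fun i : Fin n => t < (i : ℕ) + 1)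
      = Finset.univ.filter (fun i : Fin n => k ≤ (i : ℕ)) := by
    ext i
    simp only [Finset.mem_filter, Finset.mem_univ, true_and]
    constructor
    · intro h
      have : (k : ℝ) < (i : ℕ) + 1 := hkt.trans_lt h
      have h' : k < (i : ℕ) + 1 := by exact_mod_cast this
      omega
    · intro h
      have : (k : ℝ) ≤ (i : ℕ) := by exact_mod_cast h
      linarith
  rw [hfil]
  set V := ∑ i ∈ Finset.univ.filter (fun i : Fin n => k ≤ (i : ℕ)), a i ^ 2 with hV
  have hV0 : 0 ≤ V := Finset.sum_nonneg fun _ _ => sq_nonneg _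
  set c := (fun i : Fin n => (⟨(i : ℕ) % k, Nat.mod_lt _ hk⟩ : Fin k)) with hc
  -- lower bound for the first moment of the sum of absolute block sums
  have hp : (0 : ℝ) < 2 ^ n := by positivity
  have hL : 2 ^ n * (Real.sqrt k * Real.sqrt V / 2) ≤
      ∑ x, ∑ j, |radS (blk a c j) x| := by
    rw [Finset.sum_comm]
    have hj : ∀ j : Fin k, 2 ^ n * (Real.sqrt V / Real.sqrt k / 2) ≤
        ∑ x, |radS (blk a c j) x| := by
      intro j
      refine le_trans ?_ (khin n (blk a c j))
      have := tail_bound hk a ha ha0 j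
      have h2 : Real.sqrt V / Real.sqrt k ≤ Real.sqrt (∑ i, blk a c j i ^ 2) := by
        rw [← Real.sqrt_div hV0]
        apply Real.sqrt_le_sqrt
        rw [div_le_iff₀ (by linarith)]
        linarith
      gcongr
    have hsum := Finset.sum_le_sum (fun j (_ : j ∈ Finset.univ) => hj j)
    refine le_trans (le_of_eq ?_) hsum
    simp only [Finset.sum_const, Finset.card_univ, Fintype.card_fin, nsmul_eq_mul]
    have hsk : 0 < Real.sqrt k := Real.sqrt_pos.mpr (by linarith)
    have : (k : ℝ) = Real.sqrt k * Real.sqrt k := (Real.mul_self_sqrt (by linarith)).symm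
    nth_rewrite 2 [this]
    field_simp
  set F : ℝ → ℝ := fun y => max (|y| - 1) 0 ^ 2 with hFdef
  have hB := block_bound a c F (fun y => sq_nonneg _)
  have hS' : ∑ x, F (radS a x) ≤ ρ ^ 2 * 2 ^ n := by
    rw [div_le_iff₀ hp] at hS
    simpa [hFdef, radS, sgnB] using hS
  set K2 : ℝ := 2 ^ k with hK2
  set Y : (Fin n → Bool) → ℝ := fun x => ∑ j, |radS (blk a c j) x| with hY
  set m := Real.sqrt k * Real.sqrt V / 2 with hm
  have hmK : m - 1 ≤ Real.sqrt K2 * ρ := by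
    have hFm : ∀ x, Y x - 1 ≤ max (|Y x| - 1) 0 := fun x =>
      (sub_le_sub_right (le_abs_self _) 1).trans (le_max_left _ _)
    by_cases h1 : m ≤ 1
    · have : 0 ≤ Real.sqrt K2 * ρ := by positivity
      linarith
    push Not at h1
    have hcs := sq_sum_le_card_mul_sum_sq (s := (Finset.univ : Finset (Fin n → Bool)))
      (f := fun x => max (|Y x| - 1) 0)
    have hcard : ((Finset.univ : Finset (Fin n → Bool)).card : ℝ) = 2 ^ n := by simp
    rw [hcard] at hcs
    have hlow : 2 ^ n * (m - 1) ≤ ∑ x, max (|Y x| - 1) 0 := by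
      refine le_trans ?_ (Finset.sum_le_sum fun x _ => hFm x)
      rw [Finset.sum_sub_distrib, Finset.sum_const, nsmul_eq_mul, hcard]
      linarith
    have h2 : (2 ^ n * (m - 1)) ^ 2 ≤ 2 ^ n * (K2 * (ρ ^ 2 * 2 ^ n)) := by
      calc (2 ^ n * (m - 1)) ^ 2 ≤ (∑ x, max (|Y x| - 1) 0) ^ 2 :=
            pow_le_pow_left₀ (mul_nonneg hp.le (by linarith)) hlow 2
        _ ≤ _ := hcs
        _ ≤ _ := by
            apply mul_le_mul_of_nonneg_left _ hp.le
            refine hB.trans ?_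
            exact mul_le_mul_of_nonneg_left hS' (by positivity)
    have h3 : (m - 1) ^ 2 ≤ K2 * ρ ^ 2 := by
      have : (2 ^ n : ℝ) ^ 2 * (m - 1) ^ 2 ≤ (2 ^ n : ℝ) ^ 2 * (K2 * ρ ^ 2) := by
        linarith
      exact le_of_mul_le_mul_left this (by positivity)
    refine abs_le_of_sq_le_sq' ?_ (by positivity) |>.2
    rw [mul_pow, Real.sq_sqrt (by positivity)]; exact h3
  have hKK : Real.sqrt K2 ≤ ((2 * t - 1) / (t - 1)) ^ (t / 2) := by
    have hbase : 2 ≤ (2 * t - 1) / (t - 1) := by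
      rw [le_div_iff₀ (by linarith)]; linarith
    calc Real.sqrt K2 = (2 : ℝ) ^ ((k : ℝ) / 2) := by
          rw [Real.sqrt_eq_rpow, hK2, ← Real.rpow_natCast, ← Real.rpow_mul (by norm_num)]
          congr 1; ring
      _ ≤ (2 : ℝ) ^ (t / 2) := Real.rpow_le_rpow_of_exponent_le (by norm_num) (by linarith)
      _ ≤ _ := Real.rpow_le_rpow (by norm_num) hbase (by linarith)
  set K := ((2 * t - 1) / (t - 1)) ^ (t / 2)
  have hKρ : Real.sqrt K2 * ρ ≤ K * ρ := mul_le_mul_of_nonneg_right hKK hρ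
  have hKρ0 : 0 ≤ K * ρ := le_trans (by positivity) hKρ
  have hst : Real.sqrt t ≤ 2 * Real.sqrt k := by
    rw [Real.sqrt_le_left (by positivity), mul_pow, Real.sq_sqrt (by linarith)]
    linarith
  rw [div_mul_eq_mul_div, le_div_iff₀ (Real.sqrt_pos.mpr ht0)]
  have := mul_le_mul_of_nonneg_left hst (Real.sqrt_nonneg V)
  linarith
end

section
/- Let f : {-γ,γ⁻¹}^n → {-1,1} with Walsh–Fourier expansion f = Σ_T a_T w_T on the biased cube with measure μₙ = (β·δ_{-γ} + α·δ_{γ⁻¹})^⊗n, γ = √(α/β), and let ρ = (Σ_{|T|>1} a_T²)^{1/2}. Then there exist a universal constant c₀ > 0 and an index k ∈ [n] such that if ρ·ln(e/ρ) < c₀α, then ‖f - (a_∅ + a_{k}w_{k})‖₂ ≤ 2ρ. -/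
open Classical

/-- The coordinate value on the biased cube `{-γ, γ⁻¹}`:
`true ↦ γ⁻¹`, `false ↦ -γ`. -/
noncomputable def χb (γ : ℝ) (b : Bool) : ℝ := if b then γ⁻¹ else -γ

/-- Expectation with respect to `μₙ = (β·δ_{-γ} + α·δ_{γ⁻¹})^⊗n`. -/
noncomputable def Eb (n : ℕ) (α β : ℝ) (f : (Fin n → Bool) → ℝ) : ℝ :=
  ∑ x : Fin n → Bool, (∏ i, if x i then α else β) * f x

/-- The Walsh function `w_T(x) = ∏_{i∈T} xᵢ`. -/
noncomputable def wW (n : ℕ) (γ : ℝ) (T : Finset (Fin n)) (x : Fin n → Bool) : ℝ :=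
  ∏ i ∈ T, χb γ (x i)

/-- The Walsh–Fourier coefficient `a_T = ∫ f·w_T dμₙ`. -/
noncomputable def coeff (n : ℕ) (α β γ : ℝ) (f : (Fin n → Bool) → ℝ)
    (T : Finset (Fin n)) : ℝ :=
  Eb n α β (fun x => f x * wW n γ T x)

/-- one-point weight -/
noncomputable def pb (α β : ℝ) (b : Bool) : ℝ := if b then α else β

lemma Eb_eq (n : ℕ) (α β : ℝ) (f : (Fin n → Bool) → ℝ) :
    Eb n α β f = ∑ x : Fin n → Bool, (∏ i, pb α β (x i)) * f x := rfl

lemma sum_prod_gen {R : Type*} [CommRing R] (n : ℕ) (q : Fin n → Bool → R) :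
    ∑ x : Fin n → Bool, ∏ i, q i (x i) = ∏ i, (q i true + q i false) := by
  have h := Finset.prod_univ_sum (fun _ : Fin n => (Finset.univ : Finset Bool)) q
  rw [Fintype.piFinset_univ] at h
  rw [← h]
  simp

lemma sum_weight (n : ℕ) (α β : ℝ) (hab : α + β = 1) :
    ∑ x : Fin n → Bool, ∏ i, pb α β (x i) = 1 := by
  rw [sum_prod_gen n (fun _ => pb α β)]
  simp [pb, hab]

lemma weight_pos (n : ℕ) {α β : ℝ} (ha : 0 < α) (hb : 0 < β) (x : Fin n → Bool) :
    0 < ∏ i, pb α β (x i) := by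
  apply Finset.prod_pos
  intro i _
  unfold pb
  split_ifs <;> assumption

lemma wW_eq (n : ℕ) (γ : ℝ) (T : Finset (Fin n)) (x : Fin n → Bool) :
    wW n γ T x = ∏ i, if i ∈ T then χb γ (x i) else 1 := by
  unfold wW
  rw [Finset.prod_ite_mem, Finset.univ_inter]

lemma orthonormal_wW (n : ℕ) {α β γ : ℝ} (hab : α + β = 1)
    (h1 : α * γ⁻¹ = β * γ) (h2 : α * γ⁻¹ ^ 2 = β) (h3 : β * γ ^ 2 = α)
    (S T : Finset (Fin n)) :
    Eb n α β (fun x => wW n γ S x * wW n γ T x) = if S = T then 1 else 0 := by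
  rw [Eb_eq]
  simp_rw [wW_eq, ← Finset.prod_mul_distrib]
  rw [sum_prod_gen n (fun i b => pb α β b *
    ((if i ∈ S then χb γ b else 1) * (if i ∈ T then χb γ b else 1)))]
  split_ifs with h
  · subst h
    apply Finset.prod_eq_one
    intro i _
    by_cases hi : i ∈ S <;> simp [hi, pb, χb] <;> nlinarith
  · have : ∃ i, ¬ (i ∈ S ↔ i ∈ T) := by
      by_contra hc
      push Not at hc
      exact h (Finset.ext hc)
    obtain ⟨i, hi⟩ := this
    apply Finset.prod_eq_zero (Finset.mem_univ i)
    by_cases hS : i ∈ S <;> by_cases hT : i ∈ T <;> simp [hS, hT, pb, χb] at hi ⊢ <;> linarith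

lemma kernel_wW (n : ℕ) {α β γ : ℝ} (ha : 0 < α) (hb : 0 < β) (hg : γ ≠ 0) (hab : α + β = 1)
    (h2 : α * γ⁻¹ ^ 2 = β) (h3 : β * γ ^ 2 = α)
    (x y : Fin n → Bool) :
    (∏ i, pb α β (x i)) * ∑ T : Finset (Fin n), wW n γ T x * wW n γ T y
      = if x = y then 1 else 0 := by
  have : ∑ T : Finset (Fin n), wW n γ T x * wW n γ T y
      = ∏ i, (1 + χb γ (x i) * χb γ (y i)) := by
    rw [Finset.prod_one_add, Finset.powerset_univ]
    apply Finset.sum_congr rfl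
    intro T _
    unfold wW
    rw [Finset.prod_mul_distrib]
  rw [this, ← Finset.prod_mul_distrib]
  split_ifs with h
  · subst h
    apply Finset.prod_eq_one
    intro i _
    cases x i <;> simp [pb, χb] <;> nlinarith
  · have : ∃ i, x i ≠ y i := by
      by_contra hc
      push Not at hc
      exact h (funext hc)
    obtain ⟨i, hi⟩ := this
    apply Finset.prod_eq_zero (Finset.mem_univ i)
    cases hx : x i <;> cases hy : y i <;> simp [hx, hy, χb, hg] at hi ⊢

lemma parseval (n : ℕ) {α β γ : ℝ} (ha : 0 < α) (hb : 0 < β) (hg : γ ≠ 0) (hab : α + β = 1)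
    (h2 : α * γ⁻¹ ^ 2 = β) (h3 : β * γ ^ 2 = α) (f : (Fin n → Bool) → ℝ) :
    ∑ T : Finset (Fin n), coeff n α β γ f T ^ 2 = Eb n α β (fun x => f x ^ 2) := by
  have key : ∀ T : Finset (Fin n), coeff n α β γ f T ^ 2 =
      ∑ x : Fin n → Bool, ∑ y : Fin n → Bool, ((∏ i, pb α β (y i)) * f x * f y) *
        ((∏ i, pb α β (x i)) * (wW n γ T x * wW n γ T y)) := by
    intro T
    rw [sq, coeff, Eb_eq, Finset.sum_mul_sum]
    refine Finset.sum_congr rfl fun x _ => Finset.sum_congr rfl fun y _ => ?_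
    ring
  simp_rw [key]
  rw [Finset.sum_comm, Eb_eq]
  refine Finset.sum_congr rfl fun x _ => ?_
  rw [Finset.sum_comm]
  simp_rw [← Finset.mul_sum, kernel_wW n ha hb hg hab h2 h3]
  simp
  ring

lemma Eb_add (n : ℕ) (α β : ℝ) (f g : (Fin n → Bool) → ℝ) :
    Eb n α β (fun x => f x + g x) = Eb n α β f + Eb n α β g := by
  simp [Eb, mul_add, Finset.sum_add_distrib]

lemma Eb_smul (n : ℕ) (α β c : ℝ) (f : (Fin n → Bool) → ℝ) :
    Eb n α β (fun x => c * f x) = c * Eb n α β f := by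
  unfold Eb
  rw [Finset.mul_sum]
  exact Finset.sum_congr rfl fun x _ => by ring

lemma Eb_sum {ι : Type*} (s : Finset ι) (n : ℕ) (α β : ℝ) (F : ι → (Fin n → Bool) → ℝ) :
    Eb n α β (fun x => ∑ i ∈ s, F i x) = ∑ i ∈ s, Eb n α β (F i) := by
  unfold Eb
  simp_rw [Finset.mul_sum]
  rw [Finset.sum_comm]

lemma Eb_mono (n : ℕ) {α β : ℝ} (ha : 0 < α) (hb : 0 < β) {f g : (Fin n → Bool) → ℝ}
    (h : ∀ x, f x ≤ g x) : Eb n α β f ≤ Eb n α β g := by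
  simp_rw [Eb_eq]
  exact Finset.sum_le_sum fun x _ => mul_le_mul_of_nonneg_left (h x) (weight_pos n ha hb x).le

lemma Eb_const (n : ℕ) {α β : ℝ} (hab : α + β = 1) (c : ℝ) :
    Eb n α β (fun _ => c) = c := by
  rw [Eb_eq, ← Finset.sum_mul, sum_weight n α β hab, one_mul]

lemma proj_norm (n : ℕ) {α β γ : ℝ} (ha : 0 < α) (hb : 0 < β) (hg : γ ≠ 0) (hab : α + β = 1)
    (h1 : α * γ⁻¹ = β * γ)
    (h2 : α * γ⁻¹ ^ 2 = β) (h3 : β * γ ^ 2 = α) (f : (Fin n → Bool) → ℝ)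
    (S : Finset (Finset (Fin n))) :
    Eb n α β (fun x => (f x - ∑ T ∈ S, coeff n α β γ f T * wW n γ T x) ^ 2)
      = ∑ T ∈ Sᶜ, coeff n α β γ f T ^ 2 := by
  have hc : ∀ U, coeff n α β γ (fun x => f x - ∑ T ∈ S, coeff n α β γ f T * wW n γ T x) U
      = if U ∈ S then 0 else coeff n α β γ f U := by
    intro U
    have e1 : coeff n α β γ (fun x => f x - ∑ T ∈ S, coeff n α β γ f T * wW n γ T x) U
        = coeff n α β γ f U + Eb n α β (fun x => ∑ T ∈ S,
          (- coeff n α β γ f T) * (wW n γ T x * wW n γ U x)) := by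
      conv_rhs => rw [coeff]
      rw [← Eb_add, coeff]
      congr 1
      funext x
      rw [sub_mul, Finset.sum_mul, sub_eq_add_neg, ← Finset.sum_neg_distrib]
      congr 1
      exact Finset.sum_congr rfl fun T _ => by ring
    rw [e1, Eb_sum]
    simp_rw [Eb_smul, orthonormal_wW n hab h1 h2 h3]
    split_ifs with hU <;> simp [hU]
  rw [← parseval n ha hb hg hab h2 h3]
  simp_rw [hc]
  rw [← Finset.sum_add_sum_compl S]
  rw [Finset.sum_eq_zero, zero_add]
  · refine Finset.sum_congr rfl fun T hT => ?_
    rw [if_neg (Finset.mem_compl.mp hT)]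
  · intro T hT
    simp [hT]

/-- averaging over one coordinate -/
lemma Eb_update (n : ℕ) {α β : ℝ} (hab : α + β = 1) (F : (Fin n → Bool) → ℝ) (i : Fin n) :
    α * Eb n α β (fun x => F (Function.update x i true))
      + β * Eb n α β (fun x => F (Function.update x i false)) = Eb n α β F := by
  have hw : ∀ x : Fin n → Bool, ∏ j, pb α β (x j)
      = pb α β (x i) * ∏ j ∈ Finset.univ.erase i, pb α β (x j) :=
    fun x => (Finset.mul_prod_erase _ _ (Finset.mem_univ i)).symm
  let e : (Fin n → Bool) ≃ (Fin n → Bool) :=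
    { toFun := fun x => Function.update x i (!(x i))
      invFun := fun x => Function.update x i (!(x i))
      left_inv := fun x => by simp
      right_inv := fun x => by simp }
  have he : ∀ G : (Fin n → Bool) → ℝ, ∑ x, G (e x) = ∑ x, G x := fun G => Equiv.sum_comp e G
  have hm : ∀ x b, ∏ j ∈ Finset.univ.erase i, pb α β (Function.update x i b j)
      = ∏ j ∈ Finset.univ.erase i, pb α β (x j) := by
    intro x b
    refine Finset.prod_congr rfl fun j hj => ?_
    rw [Function.update_of_ne (Finset.ne_of_mem_erase hj)]
  have hstep : ∀ x : Fin n → Bool,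
      α * ((∏ j, pb α β (x j)) * F (Function.update x i true))
      + β * ((∏ j, pb α β (x j)) * F (Function.update x i false))
      = (∏ j, pb α β (x j)) * (pb α β (x i) * F x) +
        (∏ j, pb α β (e x j)) * (pb α β (x i) * F (e x)) := by
    intro x
    rw [hw x, hw (e x)]
    simp only [e, Equiv.coe_fn_mk, hm, Function.update_self]
    cases hx : x i
    · have : Function.update x i false = x := by rw [← hx]; simp
      rw [this]; simp [pb]; ring
    · have : Function.update x i true = x := by rw [← hx]; simp
      rw [this]; simp [pb]; ring
  simp_rw [Eb_eq]
  rw [Finset.mul_sum, Finset.mul_sum, ← Finset.sum_add_distrib, Finset.sum_congr rfl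
    (fun x _ => hstep x), Finset.sum_add_distrib]
  have h4 := he (fun x => (∏ j, pb α β (x j)) * (pb α β (!(x i)) * F x))
  have h5 : ∀ x, (!(e x i)) = x i := by intro x; simp [e]
  simp only [h5] at h4
  rw [h4, ← Finset.sum_add_distrib]
  refine Finset.sum_congr rfl fun x _ => ?_
  cases x i <;> simp [pb] <;> linear_combination ((∏ j, if x j = true then α else β) * F x) * hab

lemma Eb_update_le (n : ℕ) {α β : ℝ} (ha : 0 < α) (hb : 0 < β) (hle : α ≤ β) (hab : α + β = 1)
    (F : (Fin n → Bool) → ℝ) (hF : ∀ x, 0 ≤ F x) (i : Fin n) (b : Bool) :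
    α * Eb n α β (fun x => F (Function.update x i b)) ≤ Eb n α β F := by
  have h := Eb_update n hab F i
  have nn : ∀ c, 0 ≤ Eb n α β (fun x => F (Function.update x i c)) := by
    intro c
    rw [← Eb_const n hab 0]
    exact Eb_mono n ha hb fun x => hF _
  have h1 := nn true
  have h2 := nn false
  cases b <;> nlinarith [mul_nonneg ha.le h1, mul_nonneg hb.le h2,
    mul_le_mul_of_nonneg_right hle h2]

lemma Eb_update2_le (n : ℕ) {α β : ℝ} (ha : 0 < α) (hb : 0 < β) (hle : α ≤ β) (hab : α + β = 1)
    (F : (Fin n → Bool) → ℝ) (hF : ∀ x, 0 ≤ F x) (i j : Fin n) (b c : Bool) :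
    α ^ 2 * Eb n α β (fun x => F (Function.update (Function.update x i b) j c)) ≤ Eb n α β F := by
  have h1 := Eb_update_le n ha hb hle hab F hF j c
  have h2 := Eb_update_le n ha hb hle hab (fun x => F (Function.update x j c))
    (fun x => hF _) i b
  nlinarith

/-- the affine part -/
noncomputable def aff (n : ℕ) (γ a0 : ℝ) (a : Fin n → ℝ) (x : Fin n → Bool) : ℝ :=
  a0 + ∑ i, a i * χb γ (x i)

lemma aff_update (n : ℕ) (γ a0 : ℝ) (a : Fin n → ℝ) (x : Fin n → Bool) (i : Fin n) :
    aff n γ a0 a (Function.update x i true) - aff n γ a0 a (Function.update x i false)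
      = a i * (γ⁻¹ + γ) := by
  unfold aff
  rw [← Finset.add_sum_erase _ _ (Finset.mem_univ i),
    ← Finset.add_sum_erase (Finset.univ) (fun j => a j * χb γ (Function.update x i false j))
      (Finset.mem_univ i)]
  have : ∀ b, ∑ j ∈ Finset.univ.erase i, a j * χb γ (Function.update x i b j)
      = ∑ j ∈ Finset.univ.erase i, a j * χb γ (x j) := by
    intro b
    refine Finset.sum_congr rfl fun j hj => ?_
    rw [Function.update_of_ne (Finset.ne_of_mem_erase hj)]
  rw [this, this]
  simp [χb]
  ring

lemma big_unique (n : ℕ) {α β γ a0 ρ : ℝ} (ha : 0 < α) (hb : 0 < β) (hle : α ≤ β)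
    (hab : α + β = 1) (a : Fin n → ℝ)
    (f : (Fin n → Bool) → ℝ) (hf : ∀ x, f x = -1 ∨ f x = 1)
    (hE : Eb n α β (fun x => (f x - aff n γ a0 a x) ^ 2) ≤ ρ ^ 2) (hρ0 : 0 ≤ ρ)
    (hρ : ρ < 1 / 20 * α) (i j : Fin n) (hij : i ≠ j)
    (hi : 1 < |a i * (γ⁻¹ + γ)|) (hj : 1 < |a j * (γ⁻¹ + γ)|) : False := by
  set F : (Fin n → Bool) → ℝ := fun x => (f x - aff n γ a0 a x) ^ 2 with hFdef
  have hF : ∀ x, 0 ≤ F x := fun x => sq_nonneg _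
  let u : (Fin n → Bool) → Bool → Bool → (Fin n → Bool) :=
    fun x b c => Function.update (Function.update x i b) j c
  have hall : ∀ b c, Eb n α β (fun x => F (u x b c)) < 1 / 400 := by
    intro b c
    have h := Eb_update2_le n ha hb hle hab F hF i j b c
    have : α ^ 2 * Eb n α β (fun x => F (u x b c)) < α ^ 2 * (1 / 400) := by
      refine lt_of_le_of_lt (h.trans hE) ?_
      nlinarith
    exact lt_of_mul_lt_mul_left this (by positivity)
  have hex : ∃ y, (F (u y false false) + F (u y false true)) +
      (F (u y true false) + F (u y true true)) < 1 / 100 := by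
    by_contra hc
    push Not at hc
    have h := Eb_mono n ha hb hc
    rw [Eb_const n hab, Eb_add, Eb_add, Eb_add] at h
    linarith [hall false false, hall false true, hall true false, hall true true]
  obtain ⟨y, hy⟩ := hex
  have hs : ∀ b c, |f (u y b c) - aff n γ a0 a (u y b c)| < 1 / 10 := by
    intro b c
    apply abs_lt_of_sq_lt_sq _ (by norm_num)
    have : F (u y b c) < 1 / 100 := by
      have := hF (u y false false)
      have := hF (u y false true)
      have := hF (u y true false)
      have := hF (u y true true)
      cases b <;> cases c <;> linarith
    calc _ = F (u y b c) := rfl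
      _ < _ := by linarith
  have dj : ∀ b, aff n γ a0 a (u y b true) - aff n γ a0 a (u y b false) = a j * (γ⁻¹ + γ) :=
    fun b => aff_update n γ a0 a _ j
  have di : ∀ c, aff n γ a0 a (u y true c) - aff n γ a0 a (u y false c) = a i * (γ⁻¹ + γ) := by
    intro c
    have := aff_update n γ a0 a (Function.update y j c) i
    simp only [u]
    rw [Function.update_comm hij, Function.update_comm hij]
    exact this
  have s00 := abs_lt.mp (hs false false)
  have s01 := abs_lt.mp (hs false true)
  have s10 := abs_lt.mp (hs true false)
  have s11 := abs_lt.mp (hs true true)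
  have d1 := dj true
  have d2 := dj false
  have d3 := di true
  have d4 := di false
  rcases lt_abs.mp hi with hi | hi <;> rcases lt_abs.mp hj with hj | hj <;>
  rcases hf (u y false false) with e1 | e1 <;> rcases hf (u y false true) with e2 | e2 <;>
  rcases hf (u y true false) with e3 | e3 <;> rcases hf (u y true true) with e4 | e4 <;>
  rw [e1] at s00 <;> rw [e2] at s01 <;> rw [e3] at s10 <;> rw [e4] at s11 <;> linarith

lemma factor_le {α β γ : ℝ} (ha : 0 < α) (hb : 0 < β) (hab : α + β = 1)
    (hd : α * β * (γ⁻¹ + γ) ^ 2 = 1) (a : ℝ) :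
    ‖(α : ℂ) * Complex.exp (((Real.pi * (a * γ⁻¹) : ℝ) : ℂ) * Complex.I)
      + (β : ℂ) * Complex.exp (((Real.pi * (a * (-γ)) : ℝ) : ℂ) * Complex.I)‖ ^ 2
      ≤ if |a * (γ⁻¹ + γ)| ≤ 1 then Real.exp (- (4 * a ^ 2)) else 1 := by
  have e : ‖(α : ℂ) * Complex.exp (((Real.pi * (a * γ⁻¹) : ℝ) : ℂ) * Complex.I)
      + (β : ℂ) * Complex.exp (((Real.pi * (a * (-γ)) : ℝ) : ℂ) * Complex.I)‖ ^ 2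
      = 1 - 2 * (α * β) * (1 - Real.cos (Real.pi * (a * (γ⁻¹ + γ)))) := by
    have : Real.pi * (a * (γ⁻¹ + γ)) = Real.pi * (a * γ⁻¹) - Real.pi * (a * (-γ)) := by ring
    rw [this, Real.cos_sub, ← Complex.normSq_eq_norm_sq, Complex.normSq_apply]
    generalize Real.pi * (a * γ⁻¹) = A
    generalize Real.pi * (a * (-γ)) = B
    simp only [Complex.add_re, Complex.add_im, Complex.re_ofReal_mul, Complex.im_ofReal_mul,
      Complex.exp_ofReal_mul_I_re, Complex.exp_ofReal_mul_I_im]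
    have hA := Real.sin_sq_add_cos_sq A
    have hB := Real.sin_sq_add_cos_sq B
    linear_combination α ^ 2 * hA + β ^ 2 * hB + (α + β + 1) * hab
  rw [e]
  have hab0 : 0 < α * β := mul_pos ha hb
  split_ifs with h
  · have hc := Real.cos_le_one_sub_mul_cos_sq (x := Real.pi * (a * (γ⁻¹ + γ))) (by
      rw [abs_mul, abs_of_pos Real.pi_pos]
      nlinarith [Real.pi_pos])
    have hpi : 2 / Real.pi ^ 2 * (Real.pi * (a * (γ⁻¹ + γ))) ^ 2 = 2 * (a ^ 2 * (γ⁻¹ + γ) ^ 2) := by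
      have := Real.pi_pos.ne'
      field_simp
    rw [hpi] at hc
    have h4 : 2 * (α * β) * (1 - Real.cos (Real.pi * (a * (γ⁻¹ + γ)))) ≥ 4 * a ^ 2 := by
      have : 2 * (α * β) * (2 * (a ^ 2 * (γ⁻¹ + γ) ^ 2)) = 4 * a ^ 2 := by
        linear_combination (4 * a ^ 2) * hd
      rw [← this]
      apply mul_le_mul_of_nonneg_left _ (by positivity)
      linarith
    have := Real.add_one_le_exp (- (4 * a ^ 2))
    linarith
  · have := Real.cos_le_one (Real.pi * (a * (γ⁻¹ + γ)))
    nlinarith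

lemma char_bound (n : ℕ) {α β γ a0 ρ : ℝ} (ha : 0 < α) (hb : 0 < β)
    (hab : α + β = 1) (hd : α * β * (γ⁻¹ + γ) ^ 2 = 1) (a : Fin n → ℝ)
    (f : (Fin n → Bool) → ℝ) (hf : ∀ x, f x = -1 ∨ f x = 1)
    (hE : Eb n α β (fun x => (f x - aff n γ a0 a x) ^ 2) ≤ ρ ^ 2) (hρ0 : 0 ≤ ρ)
    (hρ : ρ < 1 / 40) (k : Fin n) (hk : ∀ i, i ≠ k → |a i * (γ⁻¹ + γ)| ≤ 1) :
    ∑ i ∈ Finset.univ.erase k, a i ^ 2 ≤ 3 * ρ ^ 2 := by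
  set V := ∑ i ∈ Finset.univ.erase k, a i ^ 2 with hV
  -- the complex expectation
  set W : ℂ := ∑ x : Fin n → Bool, ((∏ i, pb α β (x i) : ℝ) : ℂ) *
    Complex.exp (((Real.pi * (aff n γ a0 a x) : ℝ) : ℂ) * Complex.I) with hW
  have hWprod : W = Complex.exp (((Real.pi * a0 : ℝ) : ℂ) * Complex.I) *
      ∏ i, ((α : ℂ) * Complex.exp (((Real.pi * (a i * γ⁻¹) : ℝ) : ℂ) * Complex.I)
      + (β : ℂ) * Complex.exp (((Real.pi * (a i * (-γ)) : ℝ) : ℂ) * Complex.I)) := by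
    have := sum_prod_gen n (fun i b => ((pb α β b : ℝ) : ℂ) *
      Complex.exp (((Real.pi * (a i * χb γ b) : ℝ) : ℂ) * Complex.I))
    simp only [pb, χb] at this
    simp only [if_true, Bool.false_eq_true, if_false] at this
    rw [← this, hW, Finset.mul_sum]
    refine Finset.sum_congr rfl fun x _ => ?_
    rw [Finset.prod_mul_distrib, ← Complex.exp_sum, mul_left_comm, ← Complex.exp_add]
    congr 1
    · rw [Complex.ofReal_prod]; rfl
    · congr 1
      rw [← Finset.sum_mul, ← add_mul, ← Complex.ofReal_sum, ← Complex.ofReal_add]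
      congr 2
      unfold aff
      rw [mul_add, Finset.mul_sum]
      rfl
  have hupper : ‖W‖ ^ 2 ≤ Real.exp (- (4 * V)) := by
    rw [hWprod, norm_mul, Complex.norm_exp_ofReal_mul_I, one_mul, norm_prod, ← Finset.prod_pow,
      ← Finset.mul_prod_erase _ _ (Finset.mem_univ k)]
    have hkk := factor_le ha hb hab hd (a k)
    have hkk1 : ‖(α : ℂ) * Complex.exp (((Real.pi * (a k * γ⁻¹) : ℝ) : ℂ) * Complex.I)
      + (β : ℂ) * Complex.exp (((Real.pi * (a k * (-γ)) : ℝ) : ℂ) * Complex.I)‖ ^ 2 ≤ 1 := by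
      refine hkk.trans ?_
      split_ifs
      · rw [Real.exp_le_one_iff]
        nlinarith [sq_nonneg (a k)]
      · exact le_rfl
    have hrest : Real.exp (- (4 * V)) = ∏ i ∈ Finset.univ.erase k, Real.exp (- (4 * a i ^ 2)) := by
      rw [← Real.exp_sum, hV, Finset.mul_sum, Finset.sum_neg_distrib]
    rw [hrest, ← one_mul (∏ i ∈ Finset.univ.erase k, Real.exp (- (4 * a i ^ 2)))]
    apply mul_le_mul hkk1 _ (Finset.prod_nonneg fun i _ => sq_nonneg _) zero_le_one
    apply Finset.prod_le_prod (fun i _ => sq_nonneg _)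
    intro i hi
    have := factor_le ha hb hab hd (a i)
    rwa [if_pos (hk i (Finset.ne_of_mem_erase hi))] at this
  have hlower : 1 - Real.pi ^ 2 / 2 * ρ ^ 2 ≤ ‖W‖ := by
    have hre : (-W).re = Eb n α β (fun x => Real.cos (Real.pi * (f x - aff n γ a0 a x))) := by
      rw [Eb_eq, hW, Complex.neg_re, Complex.re_sum, ← Finset.sum_neg_distrib]
      refine Finset.sum_congr rfl fun x _ => ?_
      rw [Complex.re_ofReal_mul, Complex.exp_ofReal_mul_I_re, ← mul_neg]
      congr 1
      rw [mul_sub, Real.cos_sub]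
      rcases hf x with h | h <;> simp [h]
    have h1 : (-W).re ≤ ‖W‖ := by
      rw [← norm_neg]
      exact Complex.re_le_norm _
    refine le_trans ?_ h1
    rw [hre]
    have h2 : Eb n α β (fun x => 1 + (- (Real.pi ^ 2 / 2)) * (f x - aff n γ a0 a x) ^ 2)
        ≤ Eb n α β (fun x => Real.cos (Real.pi * (f x - aff n γ a0 a x))) := by
      apply Eb_mono n ha hb
      intro x
      have := Real.one_sub_sq_div_two_le_cos (x := Real.pi * (f x - aff n γ a0 a x))
      refine le_trans (le_of_eq ?_) this
      ring
    rw [Eb_add, Eb_const n hab, Eb_smul] at h2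
    have h3 : Real.pi ^ 2 / 2 * Eb n α β (fun x => (f x - aff n γ a0 a x) ^ 2)
      ≤ Real.pi ^ 2 / 2 * ρ ^ 2 := mul_le_mul_of_nonneg_left hE (by positivity)
    linarith
  have hpi : Real.pi ^ 2 < 10 := by nlinarith [Real.pi_lt_d2, Real.pi_pos]
  have hr : ρ ^ 2 < 1 / 1600 := by nlinarith
  have hp : Real.pi ^ 2 * ρ ^ 2 ≤ 10 * ρ ^ 2 := mul_le_mul_of_nonneg_right hpi.le (sq_nonneg _)
  have hl2 : 1 - 10 * ρ ^ 2 ≤ Real.exp (- (4 * V)) := by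
    have : 1 - 5 * ρ ^ 2 ≤ ‖W‖ := by linarith
    nlinarith [sq_nonneg (ρ ^ 2)]
  have hV1 := Real.add_one_le_exp (4 * V)
  have hmul : Real.exp (4 * V) * Real.exp (- (4 * V)) = 1 := by
    rw [← Real.exp_add]; simp
  have hV0 : 0 ≤ V := Finset.sum_nonneg fun i _ => sq_nonneg _
  have h5 : (4 * V + 1) * (1 - 10 * ρ ^ 2) ≤ 1 := by
    refine le_trans (mul_le_mul hV1 hl2 (by linarith) (Real.exp_pos _).le) hmul.le
  nlinarith [sq_nonneg ρ]

/-- Theorem 2 (biased FKN): there is a universal constant `c₀ > 0` such that for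
every Boolean `f` on the biased cube with `ρ = (∑_{|T|>1} a_T²)^{1/2}` there is
`k ∈ [n]` with: if `ρ·ln(e/ρ) < c₀·α` then `‖f - (a_∅ + a_{k}w_{k})‖₂ ≤ 2ρ`. -/
theorem stmt_16 :
    ∃ c₀ : ℝ, 0 < c₀ ∧
      ∀ (n : ℕ), 0 < n → ∀ (α β γ : ℝ), 0 < α → α < 1 / 2 → 0 < β → α + β = 1 →
        γ = Real.sqrt (α / β) →
        ∀ f : (Fin n → Bool) → ℝ, (∀ x, f x = -1 ∨ f x = 1) →
        ∀ ρ : ℝ,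
          ρ = Real.sqrt (∑ T ∈ Finset.univ.filter
                (fun T : Finset (Fin n) => 1 < T.card), (coeff n α β γ f T) ^ 2) →
          ∃ k : Fin n, ρ * Real.log (Real.exp 1 / ρ) < c₀ * α →
            Real.sqrt (Eb n α β (fun x =>
              (f x - (coeff n α β γ f ∅ + coeff n α β γ f {k} * wW n γ {k} x)) ^ 2))
              ≤ 2 * ρ := by
  refine ⟨1 / 20, by norm_num, ?_⟩
  intro n hn α β γ ha hα hb hab hγ f hf ρ hρ
  have hg : 0 < γ := by rw [hγ]; positivity
  have hg2 : γ ^ 2 = α / β := by rw [hγ]; exact Real.sq_sqrt (by positivity)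
  have h3 : β * γ ^ 2 = α := by rw [hg2]; field_simp
  have h2 : α * γ⁻¹ ^ 2 = β := by rw [← h3]; field_simp
  have h1 : α * γ⁻¹ = β * γ := by rw [← h3]; field_simp
  have hd : α * β * (γ⁻¹ + γ) ^ 2 = 1 := by
    have : γ⁻¹ * γ = 1 := inv_mul_cancel₀ hg.ne'
    linear_combination β * h2 + α * h3 + 2 * α * β * this + (α + β + 1) * hab
  have hle : α ≤ β := by linarith
  set a : Fin n → ℝ := fun i => coeff n α β γ f {i} with hadef
  set a0 := coeff n α β γ f ∅ with ha0
  have hρ0 : 0 ≤ ρ := by rw [hρ]; exact Real.sqrt_nonneg _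
  have hρ2 : ρ ^ 2 = ∑ T ∈ Finset.univ.filter
      (fun T : Finset (Fin n) => 1 < T.card), (coeff n α β γ f T) ^ 2 := by
    rw [hρ]; exact Real.sq_sqrt (Finset.sum_nonneg fun _ _ => sq_nonneg _)
  have hpars := parseval n ha hb hg.ne' hab h2 h3 f
  have hone : Eb n α β (fun x => f x ^ 2) = 1 := by
    have : (fun x => f x ^ 2) = fun _ => (1 : ℝ) := by
      funext x; rcases hf x with h | h <;> simp [h]
    rw [this, Eb_const n hab]
  have hρ1 : ρ ≤ 1 := by
    have : ρ ^ 2 ≤ 1 := by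
      rw [hρ2, ← hone, ← hpars]
      exact Finset.sum_le_sum_of_subset_of_nonneg (Finset.filter_subset _ _)
        fun _ _ _ => sq_nonneg _
    nlinarith
  have hcond : ρ * Real.log (Real.exp 1 / ρ) < 1 / 20 * α → ρ < 1 / 20 * α := by
    intro h
    rcases hρ0.eq_or_lt with h0 | h0
    · rw [← h0]; positivity
    · rw [Real.log_div (Real.exp_pos 1).ne' h0.ne', Real.log_exp] at h
      have := Real.log_nonpos hρ0 hρ1
      nlinarith
  by_cases hc : ρ * Real.log (Real.exp 1 / ρ) < 1 / 20 * α
  swap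
  · exact ⟨⟨0, hn⟩, fun h => absurd h hc⟩
  have hρα := hcond hc
  -- the affine part as a projection
  set S : Finset (Finset (Fin n)) :=
    insert ∅ (Finset.univ.image (fun i : Fin n => ({i} : Finset (Fin n)))) with hS
  have hSsum : ∀ g : Finset (Fin n) → ℝ, ∑ T ∈ S, g T = g ∅ + ∑ i, g {i} := by
    intro g
    rw [hS, Finset.sum_insert, Finset.sum_image]
    · intro i _ j _ h
      simpa using h
    · simp
  have hScompl : Sᶜ = Finset.univ.filter (fun T : Finset (Fin n) => 1 < T.card) := by
    ext T
    simp only [hS, Finset.mem_compl, Finset.mem_insert, Finset.mem_image, Finset.mem_univ,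
      true_and, Finset.mem_filter]
    rw [← not_le, not_iff_not, Nat.le_one_iff_eq_zero_or_eq_one, Finset.card_eq_zero,
      Finset.card_eq_one]
    simp only [eq_comm]
  have hE : Eb n α β (fun x => (f x - aff n γ a0 a x) ^ 2) = ρ ^ 2 := by
    rw [hρ2, ← hScompl, ← proj_norm n ha hb hg.ne' hab h1 h2 h3 f S]
    congr 1
    funext x
    rw [hSsum]
    simp [aff, wW, hadef, ha0]
  have hexk : ∃ k : Fin n, ∀ i, i ≠ k → |a i * (γ⁻¹ + γ)| ≤ 1 := by
    by_cases hbig : ∃ k, 1 < |a k * (γ⁻¹ + γ)|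
    · obtain ⟨k, hk⟩ := hbig
      refine ⟨k, fun i hi => ?_⟩
      by_contra hcon
      exact big_unique n ha hb hle hab a f hf hE.le hρ0 hρα i k hi (not_le.mp hcon) hk
    · push Not at hbig
      exact ⟨⟨0, hn⟩, fun i _ => hbig i⟩
  obtain ⟨k, hk⟩ := hexk
  refine ⟨k, fun _ => ?_⟩
  have hV := char_bound n ha hb hab hd a f hf hE.le hρ0 (by linarith) k hk
  have hfin : Eb n α β (fun x => (f x - (a0 + coeff n α β γ f {k} * wW n γ {k} x)) ^ 2)
      = ρ ^ 2 + ∑ i ∈ Finset.univ.erase k, a i ^ 2 := by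
    have hp := proj_norm n ha hb hg.ne' hab h1 h2 h3 f {∅, {k}}
    have hne : (∅ : Finset (Fin n)) ∉ ({{k}} : Finset (Finset (Fin n))) := by
      simp [eq_comm]
    simp only [Finset.sum_insert hne, Finset.sum_singleton] at hp
    have hw0 : ∀ x, wW n γ ∅ x = 1 := fun x => by simp [wW]
    simp only [hw0, mul_one] at hp
    rw [ha0, hp]
    have t1 := Finset.sum_add_sum_compl ({∅, {k}} : Finset (Finset (Fin n)))
      (fun T => coeff n α β γ f T ^ 2)
    have t2 := Finset.sum_add_sum_compl S (fun T => coeff n α β γ f T ^ 2)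
    rw [hSsum, hScompl, ← hρ2, ← Finset.add_sum_erase _ _ (Finset.mem_univ k)] at t2
    simp only [Finset.sum_insert hne, Finset.sum_singleton] at t1
    simp only [hadef]
    linarith
  rw [hfin]
  apply Real.sqrt_le_iff.mpr
  constructor
  · linarith
  · nlinarith
end
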